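/- arXiv:math/0608287 — 4 statements merged into one kernel-verified Lean document; each statement's English description precedes it below -/
import Mathlib

section
/- Let L be a free ℤ-module of finite rank with a symmetric bilinear form · : L × L → ℤ, and let σ be an automorphism of L preserving · and satisfying σ² + σ + 1 = 0 in End(L) (hence σ³ = 1). Regard L as a module over ℰ = ℤ[ω] by letting ω act as σ, and define ⟨α,β⟩ := (1/2)·(3(α·β) − θ·(α·(σ²β − σβ))) ∈ ℂ, where θ = ω − ω̄. Then ⟨·,·⟩ is a Hermitian form: it is additive in each variable, satisfies ⟨ωα,β⟩ = ω⟨α,β⟩ (so it is ℰ-linear in the first variable and conjugate-linear in the second), satisfies ⟨α,β⟩ = conj(⟨β,α⟩), and moreover ⟨α,β⟩ ∈ θℰ for all α, β ∈ L. -/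
noncomputable section

/-- The primitive cube root of unity `ω = e^{2πi/3}`. -/
def ω : ℂ := ⟨-1/2, Real.sqrt 3 / 2⟩

/-- `θ = ω - ω̄`, a square root of `-3`. -/
def θ : ℂ := ω - (starRingEnd ℂ) ω

theorem omega_sq : ω ^ 2 = -1 - ω := by
  have h3 : Real.sqrt 3 * Real.sqrt 3 = 3 := Real.mul_self_sqrt (by norm_num)
  apply Complex.ext
  · simp [ω, sq]
    linarith
  · simp [ω, sq]
    ring

theorem conj_omega : (starRingEnd ℂ) ω = -1 - ω := by
  apply Complex.ext <;> simp [ω]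
  norm_num

theorem theta_eq : θ = 1 + 2 * ω := by
  rw [θ, conj_omega]
  ring

theorem conj_theta : (starRingEnd ℂ) θ = -θ := by
  simp [θ]

/-- For a free finite-rank ℤ-module `L` with a symmetric bilinear form `dot`
preserved by an automorphism `σ` with `σ² + σ + 1 = 0`, the form
`⟨α,β⟩ = (1/2)(3(α·β) − θ·(α·(σ²β − σβ)))` is a Hermitian form (additive in each
variable, `ℰ`-linear in the first, conjugate-linear in the second, conjugate-symmetric),
taking values in `θℰ`. -/
theorem stmt_0 (L : Type*) [AddCommGroup L] [Module ℤ L]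
    [Module.Free ℤ L] [Module.Finite ℤ L]
    (dot : L →ₗ[ℤ] L →ₗ[ℤ] ℤ)
    (hsymm : ∀ x y : L, dot x y = dot y x)
    (σ : L ≃ₗ[ℤ] L)
    (hpres : ∀ x y : L, dot (σ x) (σ y) = dot x y)
    (hσ : ∀ x : L, σ (σ x) + σ x + x = 0)
    (h : L → L → ℂ)
    (hdef : ∀ α β : L,
      h α β = (1/2) * (3 * (dot α β : ℂ) - θ * (dot α (σ (σ β) - σ β) : ℂ))) :
    (∀ α α' β : L, h (α + α') β = h α β + h α' β) ∧
    (∀ α β β' : L, h α (β + β') = h α β + h α β') ∧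
    (∀ α β : L, h (σ α) β = ω * h α β) ∧
    (∀ α β : L, h α (σ β) = (starRingEnd ℂ) ω * h α β) ∧
    (∀ α β : L, h α β = (starRingEnd ℂ) (h β α)) ∧
    (∀ α β : L, ∃ a b : ℤ, h α β = θ * ((a : ℂ) + (b : ℂ) * ω)) := by
  have dot_sigma_sigma (α β : L) : dot α (σ (σ β)) = -dot α β - dot α (σ β) := by
    have := congrArg (dot α) (hσ β)
    simp only [map_add, map_zero] at this
    linarith
  have dot_sigma_left (α β : L) : dot (σ α) β = -dot α β - dot α (σ β) := by
    have := dot_sigma_sigma (σ α) β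
    rw [hpres, hpres] at this
    linarith
  have h_eq (α β : L) : h α β = θ * ((dot α (σ β) : ℂ) - ω * (dot α β : ℂ)) := by
    rw [hdef, map_sub, dot_sigma_sigma, theta_eq]
    push_cast
    linear_combination 2 * (dot α β : ℂ) * omega_sq
  refine ⟨fun α α' β => ?_, fun α β β' => ?_, fun α β => ?_, fun α β => ?_, fun α β => ?_,
    fun α β => ⟨dot α (σ β), -dot α β, ?_⟩⟩
  · simp only [h_eq, map_add, LinearMap.add_apply]
    push_cast
    ring
  · simp only [h_eq, map_add]
    push_cast
    ring
  · rw [h_eq, h_eq, hpres, dot_sigma_left]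
    push_cast
    linear_combination θ * (dot α β : ℂ) * omega_sq
  · rw [h_eq, h_eq, dot_sigma_sigma, conj_omega]
    push_cast
    linear_combination -θ * (dot α β : ℂ) * omega_sq
  · rw [h_eq, h_eq, hsymm β (σ α), hsymm β α, dot_sigma_left]
    simp only [map_mul, map_sub, conj_theta, conj_omega, map_intCast]
    push_cast
    ring
  · rw [h_eq]
    push_cast
    ring
end
end

section
/- Let H be the ℰ-module ℰ² with the Hermitian form ⟨x,y⟩ = Σ_{i,j} C_{ij} x_i conj(y_j), where C = [[0,θ],[−θ,0]]. On the underlying rank-4 free ℤ-module (with ℤ-basis e₁, ωe₁, e₂, ωe₂) define b(x,y) := (2/3)·Re⟨x,y⟩. Then b takes values in ℤ, b(x,x) ∈ 2ℤ for all x (b is even), the Gram matrix of b with respect to this ℤ-basis has determinant 1, and the real extension of b has signature (2,2) (a maximal positive-definite subspace of ℝ⁴ has dimension 2). -/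
noncomputable section

/-- The ring of Eisenstein integers `ℰ = ℤ[ω]` as a subring of ℂ. -/
def Eis : Subring ℂ := Subring.closure {ω}

/-- The Gram matrix of the hyperbolic cell `H`. -/
def Cmat : Matrix (Fin 2) (Fin 2) ℂ := !![0, θ; -θ, 0]

/-- The Hermitian form `⟨x,y⟩ = Σ C_{ij} x_i conj(y_j)` on `ℂ²` (restricting to `H = ℰ²`). -/
def hermC (x y : Fin 2 → ℂ) : ℂ :=
  ∑ i : Fin 2, ∑ j : Fin 2, Cmat i j * x i * (starRingEnd ℂ) (y j)

/-- The real bilinear form `b(x,y) = (2/3)·Re⟨x,y⟩`. -/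
def bC (x y : Fin 2 → ℂ) : ℝ := (2/3) * (hermC x y).re

/-- The ℤ-basis `e₁, ωe₁, e₂, ωe₂` of the underlying ℤ-module of `ℰ²`. -/
def basH : Fin 4 → (Fin 2 → ℂ) := fun k =>
  if k.val % 2 = 0 then Pi.single (⟨k.val / 2, by have := k.isLt; omega⟩ : Fin 2) (1 : ℂ)
  else ω • (Pi.single (⟨k.val / 2, by have := k.isLt; omega⟩ : Fin 2) (1 : ℂ) : Fin 2 → ℂ)

/-- The Gram matrix of `b` with respect to the ℤ-basis. -/
def GramH : Matrix (Fin 4) (Fin 4) ℝ := Matrix.of fun k l => bC (basH k) (basH l)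

/-- The real extension of `b`, in coordinates with respect to the ℤ-basis. -/
def bR (x y : Fin 4 → ℝ) : ℝ := ∑ k : Fin 4, ∑ l : Fin 4, GramH k l * x k * y l

theorem sqrt_three_mul_self : Real.sqrt 3 * Real.sqrt 3 = 3 :=
  Real.mul_self_sqrt (by norm_num)

theorem exists_int_of_mem_Eis {z : ℂ} (hz : z ∈ Eis) :
    ∃ p q : ℤ, z = (p : ℂ) + (q : ℂ) * ω := by
  have hω : ω * ω = -1 - ω := by
    apply Complex.ext
    · simp only [ω, Complex.mul_re, Complex.sub_re, Complex.neg_re, Complex.one_re]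
      linarith [sqrt_three_mul_self]
    · simp only [ω, Complex.mul_im, Complex.sub_im, Complex.neg_im, Complex.one_im]
      ring
  induction hz using Subring.closure_induction with
  | mem x hx =>
    rw [Set.mem_singleton_iff] at hx
    exact ⟨0, 1, by simp [hx]⟩
  | zero => exact ⟨0, 0, by simp⟩
  | one => exact ⟨1, 0, by simp⟩
  | add x y _ _ hx hy =>
    obtain ⟨p, q, rfl⟩ := hx
    obtain ⟨r, s, rfl⟩ := hy
    exact ⟨p + r, q + s, by push_cast; ring⟩
  | neg x _ hx =>
    obtain ⟨p, q, rfl⟩ := hx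
    exact ⟨-p, -q, by push_cast; ring⟩
  | mul x y _ _ hx hy =>
    obtain ⟨p, q, rfl⟩ := hx
    obtain ⟨r, s, rfl⟩ := hy
    refine ⟨p * r - q * s, p * s + q * r - q * s, ?_⟩
    push_cast
    linear_combination (q : ℂ) * s * hω

theorem bC_eq_of_coords {x y : Fin 2 → ℂ} {p q r s : Fin 2 → ℝ}
    (hx : ∀ i, x i = (p i : ℂ) + (q i : ℂ) * ω) (hy : ∀ i, y i = (r i : ℂ) + (s i : ℂ) * ω) :
    bC x y = p 0 * s 1 + q 1 * r 0 - q 0 * r 1 - p 1 * s 0 := by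
  simp only [bC, hermC, Fin.sum_univ_two, Cmat, hx, hy, θ, ω, Matrix.of_apply,
    Matrix.cons_val_zero, Matrix.cons_val_one, Matrix.cons_val', Matrix.cons_val_fin_one,
    Complex.add_re, Complex.add_im, Complex.mul_re, Complex.mul_im, Complex.sub_re,
    Complex.sub_im, Complex.neg_re, Complex.neg_im, Complex.conj_re, Complex.conj_im,
    Complex.zero_re, Complex.zero_im, Complex.ofReal_re, Complex.ofReal_im]
  linear_combination (p 0 * s 1 + q 1 * r 0 - q 0 * r 1 - p 1 * s 0) / 3 * sqrt_three_mul_self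

theorem GramH_eq : GramH = !![0, 0, 0, 1; 0, 0, -1, 0; 0, -1, 0, 0; 1, 0, 0, 0] := by
  have h : ∀ (k : Fin 4) (i : Fin 2), basH k i =
      (((![![1, 0], ![0, 0], ![0, 1], ![0, 0]] : Fin 4 → Fin 2 → ℝ) k i : ℝ) : ℂ) +
      (((![![0, 0], ![1, 0], ![0, 0], ![0, 1]] : Fin 4 → Fin 2 → ℝ) k i : ℝ) : ℂ) * ω := by
    intro k i
    fin_cases k <;> fin_cases i <;> simp [basH]
  ext k l
  rw [GramH, Matrix.of_apply, bC_eq_of_coords (h k) (h l)]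
  fin_cases k <;> fin_cases l <;> simp

theorem bR_self (v : Fin 4 → ℝ) : bR v v = 2 * (v 0 * v 3 - v 1 * v 2) := by
  simp [bR, GramH_eq, Fin.sum_univ_four]
  ring

/-- On the underlying rank-4 ℤ-module of `H = ℰ²`, the form
`b = (2/3)Re⟨·,·⟩` is ℤ-valued and even, its Gram matrix has determinant 1, and its
real extension has signature (2,2): there is a 2-dimensional subspace of ℝ⁴ on which it
is positive definite, and every subspace on which it is positive definite has
dimension at most 2. -/
theorem stmt_5 :
    (∀ x y : Fin 2 → ℂ, (∀ i, x i ∈ Eis) → (∀ i, y i ∈ Eis) → ∃ n : ℤ, bC x y = (n : ℝ)) ∧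
    (∀ x : Fin 2 → ℂ, (∀ i, x i ∈ Eis) → ∃ n : ℤ, bC x x = 2 * (n : ℝ)) ∧
    GramH.det = 1 ∧
    (∃ W : Submodule ℝ (Fin 4 → ℝ),
      Module.finrank ℝ W = 2 ∧ ∀ v ∈ W, v ≠ 0 → 0 < bR v v) ∧
    (∀ W : Submodule ℝ (Fin 4 → ℝ),
      (∀ v ∈ W, v ≠ 0 → 0 < bR v v) → Module.finrank ℝ W ≤ 2) := by
  refine ⟨fun x y hx hy => ?_, fun x hx => ?_, ?_, ?_, fun W hW => ?_⟩
  · choose p q hpq using fun i => exists_int_of_mem_Eis (hx i)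
    choose r s hrs using fun i => exists_int_of_mem_Eis (hy i)
    refine ⟨p 0 * s 1 + q 1 * r 0 - q 0 * r 1 - p 1 * s 0, ?_⟩
    rw [bC_eq_of_coords (p := fun i => p i) (q := fun i => q i) (r := fun i => r i)
      (s := fun i => s i) (by simpa using hpq) (by simpa using hrs)]
    push_cast
    ring
  · choose p q hpq using fun i => exists_int_of_mem_Eis (hx i)
    refine ⟨p 0 * q 1 - p 1 * q 0, ?_⟩
    rw [bC_eq_of_coords (p := fun i => p i) (q := fun i => q i) (r := fun i => p i)
      (s := fun i => q i) (by simpa using hpq) (by simpa using hpq)]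
    push_cast
    ring
  · rw [GramH_eq]
    simp [Matrix.det_succ_row_zero, Fin.sum_univ_succ, Fin.succAbove]
    norm_num
  · let L : (Fin 2 → ℝ) →ₗ[ℝ] (Fin 4 → ℝ) :=
      Matrix.toLin' !![1, 0; 0, 1; 0, -1; 1, 0]
    have hL : ∀ u, L u = ![u 0, u 1, -u 1, u 0] := by
      intro u
      ext i
      fin_cases i <;> simp [L, Matrix.mulVec, dotProduct, Fin.sum_univ_two]
    have hinj : Function.Injective L := by
      intro u w huw
      rw [hL, hL] at huw
      ext i
      fin_cases i
      · exact congrFun huw 0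
      · exact congrFun huw 1
    refine ⟨LinearMap.range L, ?_, ?_⟩
    · rw [LinearMap.finrank_range_of_inj hinj, Module.finrank_fin_fun]
    · rintro _ ⟨u, rfl⟩ hu
      have hb : bR (L u) (L u) = 2 * (u 0 * u 0 + u 1 * u 1) := by
        rw [bR_self, hL]
        simp
      rw [hb]
      by_contra! h
      have h0 : u 0 = 0 := by nlinarith [mul_self_nonneg (u 0), mul_self_nonneg (u 1)]
      have h1 : u 1 = 0 := by nlinarith [mul_self_nonneg (u 0), mul_self_nonneg (u 1)]
      apply hu
      rw [hL, h0, h1]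
      ext i
      fin_cases i <;> simp
  · let M : (Fin 4 → ℝ) →ₗ[ℝ] (Fin 2 → ℝ) :=
      Matrix.toLin' !![1, 0, 0, 1; 0, 1, -1, 0]
    have hM : ∀ v, M v = ![v 0 + v 3, v 1 - v 2] := by
      intro v
      ext i
      fin_cases i <;> simp [M, Matrix.mulVec, dotProduct, Fin.sum_univ_four, sub_eq_add_neg]
    have hinj : Function.Injective (M ∘ₗ W.subtype) := by
      rw [injective_iff_map_eq_zero]
      rintro ⟨v, hv⟩ h
      replace h : M v = 0 := h
      rw [hM] at h
      have h0 : v 0 + v 3 = 0 := congrFun h 0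
      have h1 : v 1 - v 2 = 0 := congrFun h 1
      by_contra hne
      have hpos := hW v hv fun h' => hne (Subtype.ext h')
      rw [bR_self, eq_neg_of_add_eq_zero_right h0, ← sub_eq_zero.mp h1] at hpos
      nlinarith [mul_self_nonneg (v 0), mul_self_nonneg (v 1)]
    simpa using LinearMap.finrank_le_finrank_of_injective hinj
end
end

section
/- Extend the Hermitian form of Λ₁₀ to ℚ(ω)¹⁰ by the same Gram matrix. Then for every v ∈ ℚ(ω)¹⁰, one has v ∈ ℰ¹⁰ if and only if ⟨v,w⟩ ∈ θℰ for all w ∈ ℰ¹⁰. (That is, θ·Λ₁₀* = Λ₁₀, where Λ₁₀* is the dual lattice.) -/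
noncomputable section

/-- The field `ℚ(ω)` as a subfield of ℂ. -/
def QEis : Subfield ℂ := Subfield.closure {ω}

/-- The Gram matrix of `E₈^ℰ`. -/
def Bmat : Matrix (Fin 4) (Fin 4) ℂ :=
  !![3, θ, 0, 0; -θ, 3, θ, 0; 0, -θ, 3, θ; 0, 0, -θ, 3]

/-- The Gram matrix of `Λ₁₀ = E₈^ℰ ⊕ E₈^ℰ ⊕ H`: block diagonal with blocks B, B, C. -/
def Lam10 : Matrix (Fin 10) (Fin 10) ℂ := Matrix.of fun i j =>
  if h : i.val < 4 ∧ j.val < 4 then Bmat ⟨i.val, h.1⟩ ⟨j.val, h.2⟩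
  else if h : 4 ≤ i.val ∧ i.val < 8 ∧ 4 ≤ j.val ∧ j.val < 8 then
    Bmat ⟨i.val - 4, by omega⟩ ⟨j.val - 4, by omega⟩
  else if h : 8 ≤ i.val ∧ 8 ≤ j.val then
    Cmat ⟨i.val - 8, by have := i.isLt; omega⟩ ⟨j.val - 8, by have := j.isLt; omega⟩
  else 0

/-- The Hermitian form of `Λ₁₀`, extended to vectors with complex (e.g. `ℚ(ω)`) entries. -/
def herm10C (x y : Fin 10 → ℂ) : ℂ :=
  ∑ i : Fin 10, ∑ j : Fin 10, Lam10 i j * x i * (starRingEnd ℂ) (y j)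

theorem theta_sq : θ ^ 2 = -3 := by
  apply Complex.ext <;> simp [θ, ω, pow_two]

theorem theta_ne_zero : θ ≠ 0 := by
  intro h
  simpa [h] using theta_sq

theorem omega_mem_Eis : ω ∈ Eis := Subring.subset_closure rfl

theorem theta_mem_Eis : θ ∈ Eis := by
  rw [θ, conj_omega]
  exact sub_mem omega_mem_Eis (sub_mem (neg_mem (one_mem _)) omega_mem_Eis)

theorem conj_mem_Eis {z : ℂ} (hz : z ∈ Eis) : (starRingEnd ℂ) z ∈ Eis := by
  have h : Eis ≤ Eis.comap (starRingEnd ℂ) := by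
    refine Subring.closure_le.2 (Set.singleton_subset_iff.2 ?_)
    simp only [Subring.coe_comap, Set.mem_preimage, conj_omega]
    exact sub_mem (neg_mem (one_mem _)) omega_mem_Eis
  exact h hz

/-- The row vector `θ⁻¹ vᵀ Λ`, where `Λ` is the Gram matrix of `Λ₁₀`. -/
def dualCoord (v : Fin 10 → ℂ) : Fin 10 → ℂ :=
  ![-θ * v 0 - v 1, v 0 - θ * v 1 - v 2, v 1 - θ * v 2 - v 3, v 2 - θ * v 3,
    -θ * v 4 - v 5, v 4 - θ * v 5 - v 6, v 5 - θ * v 6 - v 7, v 6 - θ * v 7,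
    -v 9, v 8]

theorem sum_Lam10_mul (v : Fin 10 → ℂ) (j : Fin 10) :
    ∑ i, Lam10 i j * v i = θ * dualCoord v j := by
  fin_cases j <;>
    simp [Fin.sum_univ_succ, Lam10, Bmat, Cmat, dualCoord] <;>
    grind [theta_sq]

theorem herm10C_eq (v w : Fin 10 → ℂ) :
    herm10C v w = θ * ∑ j, dualCoord v j * (starRingEnd ℂ) (w j) := by
  simp only [herm10C, Finset.mul_sum, ← mul_assoc, ← sum_Lam10_mul]
  rw [Finset.sum_comm]
  simp only [Finset.sum_mul]

theorem dualCoord_mem_Eis {v : Fin 10 → ℂ} (hv : ∀ i, v i ∈ Eis) (j : Fin 10) :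
    dualCoord v j ∈ Eis := by
  have ht (i : Fin 10) : θ * v i ∈ Eis := mul_mem theta_mem_Eis (hv i)
  fin_cases j <;> simp only [dualCoord, neg_mul]
  · exact sub_mem (neg_mem (ht 0)) (hv 1)
  · exact sub_mem (sub_mem (hv 0) (ht 1)) (hv 2)
  · exact sub_mem (sub_mem (hv 1) (ht 2)) (hv 3)
  · exact sub_mem (hv 2) (ht 3)
  · exact sub_mem (neg_mem (ht 4)) (hv 5)
  · exact sub_mem (sub_mem (hv 4) (ht 5)) (hv 6)
  · exact sub_mem (sub_mem (hv 5) (ht 6)) (hv 7)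
  · exact sub_mem (hv 6) (ht 7)
  · exact neg_mem (hv 9)
  · exact hv 8

/-- The matrix `θ⁻¹ B` has determinant `1`, hence is invertible over the Eisenstein integers. -/
theorem mem_Eis_of_block {a b c d : ℂ} (h₀ : -θ * a - b ∈ Eis) (h₁ : a - θ * b - c ∈ Eis)
    (h₂ : b - θ * c - d ∈ Eis) (h₃ : c - θ * d ∈ Eis) :
    a ∈ Eis ∧ b ∈ Eis ∧ c ∈ Eis ∧ d ∈ Eis := by
  have ht := theta_mem_Eis
  have ha : a ∈ Eis := by
    have h := add_mem (sub_mem (sub_mem (mul_mem ht h₀) (add_mem h₁ h₁)) (mul_mem ht h₂)) h₃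
    convert h using 1
    linear_combination (a - c) * theta_sq
  have hb : b ∈ Eis := by
    convert sub_mem (neg_mem (mul_mem ht ha)) h₀ using 1
    ring
  have hc : c ∈ Eis := by
    convert sub_mem (sub_mem ha (mul_mem ht hb)) h₁ using 1
    ring
  have hd : d ∈ Eis := by
    convert sub_mem (sub_mem hb (mul_mem ht hc)) h₂ using 1
    ring
  exact ⟨ha, hb, hc, hd⟩

theorem mem_Eis_of_dualCoord_mem {v : Fin 10 → ℂ} (h : ∀ j, dualCoord v j ∈ Eis)
    (i : Fin 10) : v i ∈ Eis := by
  obtain ⟨h0, h1, h2, h3⟩ := mem_Eis_of_block (h 0) (h 1) (h 2) (h 3)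
  obtain ⟨h4, h5, h6, h7⟩ := mem_Eis_of_block (h 4) (h 5) (h 6) (h 7)
  have h8 : v 8 ∈ Eis := h 9
  have h9 : v 9 ∈ Eis := neg_mem_iff.1 (h 8)
  fin_cases i <;> assumption

/-- For `v ∈ ℚ(ω)¹⁰`, one has `v ∈ ℰ¹⁰ = Λ₁₀` if and only if
`⟨v,w⟩ ∈ θℰ` for all `w ∈ Λ₁₀`; that is, `θ·Λ₁₀* = Λ₁₀`. -/
theorem stmt_6 :
    ∀ v : Fin 10 → ℂ, (∀ i, v i ∈ QEis) →
      ((∀ i, v i ∈ Eis) ↔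
        ∀ w : Fin 10 → ℂ, (∀ i, w i ∈ Eis) → ∃ e : Eis, herm10C v w = θ * (e : ℂ)) := by
  intro v _
  constructor
  · intro hv w hw
    exact ⟨⟨_, sum_mem fun j _ => mul_mem (dualCoord_mem_Eis hv j) (conj_mem_Eis (hw j))⟩,
      herm10C_eq v w⟩
  · intro h
    refine mem_Eis_of_dualCoord_mem fun j => ?_
    obtain ⟨e, he⟩ := h (Pi.single j 1) fun i => by
      rcases eq_or_ne i j with rfl | hij
      · simp
      · simp [hij]
    rw [herm10C_eq] at he
    have he' := mul_left_cancel₀ theta_ne_zero he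
    simp only [Pi.single_apply, apply_ite (starRingEnd ℂ), map_one, map_zero, mul_ite, mul_one,
      mul_zero, Finset.sum_ite_eq', Finset.mem_univ, if_true] at he'
    exact he' ▸ e.2
end
end

section
/- Any two chordal roots of Λ are equivalent under Γ: if r and s are roots of Λ with {⟨r,x⟩ : x ∈ Λ} = 3ℰ and {⟨s,x⟩ : x ∈ Λ} = 3ℰ, then there exists γ ∈ Γ with γ(r) = s. -/
noncomputable section

/-- The Gram matrix of `Λ = (3) ⊕ Λ₁₀`: block diagonal with blocks (3), B, B, C. -/
def Lam11 : Matrix (Fin 11) (Fin 11) ℂ := Matrix.of fun i j =>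
  if i.val = 0 ∧ j.val = 0 then 3
  else if h : 1 ≤ i.val ∧ 1 ≤ j.val then
    Lam10 ⟨i.val - 1, by have := i.isLt; omega⟩ ⟨j.val - 1, by have := j.isLt; omega⟩
  else 0

/-- The Hermitian form of `Λ = ℰ¹¹`. -/
def hermE (x y : Fin 11 → Eis) : ℂ :=
  ∑ i : Fin 11, ∑ j : Fin 11, Lam11 i j * (x i : ℂ) * (starRingEnd ℂ) ((y j : ℂ))

/-- The ideal `θℰ ⊆ ℂ`. -/
def thetaEis : Set ℂ := {z | ∃ e : Eis, z = θ * (e : ℂ)}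

/-- The ideal `3ℰ ⊆ ℂ`. -/
def threeEis : Set ℂ := {z | ∃ e : Eis, z = 3 * (e : ℂ)}

/-- The set `{⟨r,x⟩ : x ∈ Λ}`. -/
def innerSetE (r : Fin 11 → Eis) : Set ℂ := {c | ∃ x : Fin 11 → Eis, c = hermE r x}

/-- The algebraic properties of `ℚ(√-3)`, with conjugation `σ`, ring of integers `O`, `τ = √-3` and
`w = (1 - √-3) / 2`, on which the classification of lattices below rests. -/
structure IsEisenstein {K : Type*} [Field K] (σ : K →+* K) (O : Subring K) (τ w : K) : Prop where
  conj_conj : ∀ x, σ (σ x) = x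
  conj_mem : ∀ x ∈ O, σ x ∈ O
  exists_den : ∀ x, ∃ d ∈ O, d ≠ 0 ∧ d * x ∈ O
  principal : ∀ I : Submodule O K, (∀ x ∈ I, x ∈ O) → (∃ x ∈ I, x ≠ 0) →
    ∃ a ∈ I, a ≠ 0 ∧ ∀ x ∈ I, ∃ q ∈ O, x = q * a
  theta_mem : τ ∈ O
  w_mem : w ∈ O
  conj_theta : σ τ = -τ
  theta_sq : τ * τ = -3
  w_add : w + σ w = 1
  w_sub : σ w - w = τ
  int_of_real : ∀ x ∈ O, σ x = x → ∃ m : ℤ, x = m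
  residue : ∀ x ∈ O, ∃ y ∈ O, x = τ * y ∨ x = 1 + τ * y ∨ x = -1 + τ * y
  norm_ne : ∀ x, x * σ x ≠ -1

section Hermitian

variable {K : Type*} [Field K] {σ : K →+* K} {O : Subring K} {τ w : K}
  {V : Type*} [AddCommGroup V] [Module K V] {B : V →ₗ[K] V →ₛₗ[σ] K} {ι : Type*}

theorem smul_mem_of_mem {U : Submodule O V} {a : K} (ha : a ∈ O) {x : V} (hx : x ∈ U) :
    a • x ∈ U :=
  U.smul_mem ⟨a, ha⟩ hx

/-- `U` is a full lattice in `V` equal to its own dual. -/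
structure IsUnimodular (B : V →ₗ[K] V →ₛₗ[σ] K) (U : Submodule O V) : Prop where
  int : ∀ x ∈ U, ∀ y ∈ U, B x y ∈ O
  dual : ∀ x, (∀ y ∈ U, B x y ∈ O) → x ∈ U
  full : ∀ x : V, ∃ d ∈ O, d ≠ 0 ∧ d • x ∈ U

/-- `v` is an orthogonal basis of `V` with norms `ε i = ±1`. -/
structure IsSystem [Fintype ι] [DecidableEq ι] (B : V →ₗ[K] V →ₛₗ[σ] K) (ε : ι → K)
    (v : ι → V) : Prop where
  orth : ∀ i j, B (v i) (v j) = if i = j then ε i else 0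
  expand : ∀ x, x = ∑ i, (ε i * B x (v i)) • v i

/-- `g` preserves the form `B`. -/
def IsIsometry (B : V →ₗ[K] V →ₛₗ[σ] K) (g : V ≃ₗ[K] V) : Prop :=
  ∀ x y, B (g x) (g y) = B x y

theorem IsIsometry.apply_symm {g : V ≃ₗ[K] V} (hg : IsIsometry B g) (x y : V) :
    B (g.symm x) y = B x (g y) := by
  rw [← hg, g.apply_symm_apply]

theorem IsIsometry.symm {g : V ≃ₗ[K] V} (hg : IsIsometry B g) : IsIsometry B g.symm := by
  intro x y
  rw [hg.apply_symm, g.apply_symm_apply]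

theorem IsIsometry.trans {g h : V ≃ₗ[K] V} (hg : IsIsometry B g) (hh : IsIsometry B h) :
    IsIsometry B (g.trans h) := by
  intro x y
  simp [hh _ _, hg _ _]

theorem exists_transvection (hE : IsEisenstein σ O τ w) (hB : ∀ x y, σ (B x y) = B y x)
    (u : V) (c : K) (h : c + σ c + c * σ c * B u u = 0) :
    ∃ g : V ≃ₗ[K] V, IsIsometry B g ∧ ∀ x, g x = x + (c * B x u) • u := by
  have key : ∀ c : K, c + σ c + c * σ c * B u u = 0 → ∀ x : V,
      (x + (c * B x u) • u) + (σ c * B (x + (c * B x u) • u) u) • u = x := by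
    intro c h x
    have : c * B x u + σ c * (B x u + c * B x u * B u u) = 0 := by
      linear_combination B x u * h
    rw [add_assoc, ← add_smul]
    simp [this]
  have h' : σ c + σ (σ c) + σ c * σ (σ c) * B u u = 0 := by
    rw [hE.conj_conj]; linear_combination h
  have key' := key (σ c) h'
  rw [hE.conj_conj] at key'
  refine ⟨{ toFun := fun x => x + (c * B x u) • u
            invFun := fun x => x + (σ c * B x u) • u
            map_add' := ?_, map_smul' := ?_
            left_inv := key c h, right_inv := key' }, ?_, fun x => rfl⟩
  · intro x y
    simp only [map_add, LinearMap.add_apply]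
    module
  · intro a x
    simp only [map_smul, LinearMap.smul_apply, smul_eq_mul, RingHom.id_apply]
    module
  · intro x y
    change B (x + (c * B x u) • u) (y + (c * B y u) • u) = B x y
    simp only [map_add, map_smul, LinearMap.add_apply, LinearMap.smul_apply, smul_eq_mul,
      map_smulₛₗ, map_mul, hB]
    linear_combination B x u * B u y * h

theorem exists_reflection (hE : IsEisenstein σ O τ w) (hB : ∀ x y, σ (B x y) = B y x)
    {x y : V} (hxy : B x x = B y y) (h : B x y ≠ B x x) :
    ∃ g : V ≃ₗ[K] V, IsIsometry B g ∧ g x = y ∧ ∀ z, B z x = 0 → B z y = 0 → g z = z := by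
  have hd : B x (y - x) ≠ 0 := by simpa [sub_eq_zero] using h
  have hd' : σ (B x (y - x)) ≠ 0 := (map_ne_zero σ).2 hd
  obtain ⟨g, hg, hgx⟩ := exists_transvection hE hB (y - x) (B x (y - x))⁻¹ (by
    rw [map_inv₀]
    field_simp
    simp only [map_sub, LinearMap.sub_apply, hB]
    linear_combination -hxy)
  refine ⟨g, hg, ?_, ?_⟩
  · rw [hgx, inv_mul_cancel₀ hd]; module
  · intro z h1 h2
    rw [hgx]; simp [h1, h2]

theorem exists_isometry_of_norm_one [CharZero K] (hE : IsEisenstein σ O τ w)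
    (hB : ∀ x y, σ (B x y) = B y x) {x y : V} (hx : B x x = 1) (hy : B y y = 1) :
    ∃ g : V ≃ₗ[K] V, IsIsometry B g ∧ g x = y ∧ ∀ z, B z x = 0 → B z y = 0 → g z = z := by
  by_cases h : B x y = 1
  · obtain ⟨g, hg, hgx, hgz⟩ := exists_reflection hE hB (x := -x) (y := y) (by simp [hx, hy]) (by
      simp only [map_neg, LinearMap.neg_apply, h, hx]; norm_num)
    obtain ⟨k, hk, hkx⟩ := exists_transvection hE hB x (-2) (by
      rw [hx, map_neg, map_ofNat]; norm_num)
    refine ⟨k.trans g, hk.trans hg, ?_, ?_⟩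
    · rw [LinearEquiv.trans_apply, hkx, hx, ← hgx]; congr 1; module
    · intro z h1 h2
      rw [LinearEquiv.trans_apply, hkx, h1, mul_zero, zero_smul, add_zero]
      exact hgz z (by simp [h1]) h2
  · exact exists_reflection hE hB (by rw [hx, hy]) (by rwa [hx])

section System

variable [Fintype ι] [DecidableEq ι] {ε : ι → K} {v : ι → V}

theorem IsSystem.map (hv : IsSystem B ε v) {g : V ≃ₗ[K] V} (hg : IsIsometry B g) :
    IsSystem B ε (g ∘ v) := by
  refine ⟨fun i j => by simp [hg _ _, hv.orth], fun x => ?_⟩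
  have := congrArg g (hv.expand (g.symm x))
  simpa [hg.apply_symm] using this

theorem IsSystem.exists_isometry (hv : IsSystem B ε v) (hε : ∀ i, ε i * ε i = 1) {v' : ι → V}
    (hv' : IsSystem B ε v') :
    ∃ g : V ≃ₗ[K] V, IsIsometry B g ∧ ∀ x, g x = ∑ i, (ε i * B x (v i)) • v' i := by
  have hlin : ∀ u u' : ι → V, ∃ f : V →ₗ[K] V, ∀ x, f x = ∑ i, (ε i * B x (u i)) • u' i := by
    intro u u'
    refine ⟨{ toFun := fun x => ∑ i, (ε i * B x (u i)) • u' i, map_add' := ?_, map_smul' := ?_ },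
      fun x => rfl⟩
    · intro x y
      simp only [map_add, LinearMap.add_apply, mul_add, add_smul, Finset.sum_add_distrib]
    · intro a x
      simp only [map_smul, LinearMap.smul_apply, smul_eq_mul, RingHom.id_apply, Finset.smul_sum,
        smul_smul]
      exact Finset.sum_congr rfl fun i _ => by ring_nf
  have hcomp : ∀ u u' : ι → V, IsSystem B ε u → IsSystem B ε u' → ∀ x,
      ∀ j, B (∑ i, (ε i * B x (u i)) • u' i) (u' j) = B x (u j) := by
    intro u u' hu hu' x j
    simp only [map_sum, LinearMap.sum_apply, map_smul, LinearMap.smul_apply, hu'.orth, smul_eq_mul,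
      mul_ite, mul_zero, Finset.sum_ite_eq', Finset.mem_univ, if_true]
    linear_combination B x (u j) * hε j
  obtain ⟨f, hf⟩ := hlin v v'
  obtain ⟨f', hf'⟩ := hlin v' v
  refine ⟨LinearEquiv.ofLinearMap f f' ?_ ?_, ?_, fun x => hf x⟩
  · ext x
    rw [LinearMap.comp_apply, hf, hf']
    simp only [hcomp _ _ hv' hv]
    exact (hv'.expand x).symm
  · ext x
    rw [LinearMap.comp_apply, hf', hf]
    simp only [hcomp _ _ hv hv']
    exact (hv.expand x).symm
  · intro x y
    change B (f x) (f y) = B x y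
    conv_lhs => rw [hf y]
    conv_rhs => rw [hv.expand y]
    simp only [map_sum, map_smulₛₗ]
    exact Finset.sum_congr rfl fun i _ => by rw [hf x, hcomp _ _ hv hv']

theorem exists_primitive_dual_pair (hE : IsEisenstein σ O τ w) (hB : ∀ x y, σ (B x y) = B y x)
    {U : Submodule O V} (hU : IsUnimodular B U) (hv : IsSystem B ε v) (hε : ∀ i, ε i * ε i = 1)
    {S : Finset ι} (hS : ∀ i ∈ S, v i ∈ U) {e : V} (he : ∀ i ∈ S, B e (v i) = 0)
    {x : V} (hx : B x e ≠ 0) :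
    ∃ c : K, c • e ∈ U ∧ ∃ f ∈ U, (∀ i ∈ S, B f (v i) = 0) ∧ B f (c • e) = 1 := by
  obtain ⟨d, hd, hd0, hde⟩ := hU.full e
  obtain ⟨d', hd', hd'0, hdx⟩ := hU.full x
  let I : Submodule O K := U.map ((B.flip (d • e)).restrictScalars O)
  have hI : ∀ y, y ∈ I ↔ ∃ u ∈ U, B u (d • e) = y := fun y => Iff.rfl
  obtain ⟨a, haI, ha0, ha⟩ := hE.principal I
    (fun y hy => by obtain ⟨u, hu, rfl⟩ := (hI y).1 hy; exact hU.int _ hu _ hde)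
    ⟨B (d' • x) (d • e), (hI _).2 ⟨_, hdx, rfl⟩, by simp [hd0, hd'0, hx]⟩
  obtain ⟨u, hu, hua⟩ := (hI a).1 haI
  have hc : ∀ z, B z (((σ a)⁻¹ * d) • e) = a⁻¹ * B z (d • e) := by
    intro z
    simp only [map_smulₛₗ, map_mul, map_inv₀, hE.conj_conj, smul_eq_mul]
    ring
  have heU : ((σ a)⁻¹ * d) • e ∈ U := by
    refine hU.dual _ fun y hy => ?_
    rw [← hB, hc]
    obtain ⟨q, hq, hqa⟩ := ha _ ((hI _).2 ⟨y, hy, rfl⟩)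
    apply hE.conj_mem
    rw [hqa, mul_comm, mul_assoc, mul_inv_cancel₀ ha0, mul_one]
    exact hq
  have hve : ∀ i ∈ S, B (v i) e = 0 := fun i hi => by rw [← hB, he i hi, map_zero]
  refine ⟨(σ a)⁻¹ * d, heU, u - ∑ i ∈ S, (ε i * B u (v i)) • v i, ?_, ?_, ?_⟩
  · refine U.sub_mem hu (U.sum_mem fun i hi => smul_mem_of_mem ?_ (hS i hi))
    have : ε i = B (v i) (v i) := by rw [hv.orth, if_pos rfl]
    exact O.mul_mem (this ▸ hU.int _ (hS i hi) _ (hS i hi)) (hU.int _ hu _ (hS i hi))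
  · intro i hi
    simp only [map_sub, LinearMap.sub_apply, map_sum, LinearMap.sum_apply, map_smul,
      LinearMap.smul_apply, hv.orth, smul_eq_mul, mul_ite, mul_zero, Finset.sum_ite_eq', hi,
      if_true]
    linear_combination -B u (v i) * hε i
  · rw [map_sub, LinearMap.sub_apply, hc, hua, inv_mul_cancel₀ ha0, map_sum, LinearMap.sum_apply,
      Finset.sum_eq_zero, sub_zero]
    intro i hi
    simp [hve i hi]

theorem exists_system_insert [CharZero K] (hE : IsEisenstein σ O τ w)
    (hB : ∀ x y, σ (B x y) = B y x) {U : Submodule O V} (hU : IsUnimodular B U)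
    (hv : IsSystem B ε v) {i₀ : ι} (h₀ : ε i₀ = -1) (h₁ : ∀ i, i ≠ i₀ → ε i = 1) {S : Finset ι}
    (hS₀ : i₀ ∉ S) (hS : ∀ i ∈ S, v i ∈ U) {j : ι} (hj : j ∉ S) (hj₀ : j ≠ i₀) :
    ∃ v', IsSystem B ε v' ∧ (∀ i ∈ S, v' i = v i) ∧ v' j ∈ U := by
  have hε : ∀ i, ε i * ε i = 1 := fun i => by
    by_cases h : i = i₀
    · rw [h, h₀]; norm_num
    · rw [h₁ i h]; norm_num
  have hne : ∀ i ∈ S, i ≠ i₀ ∧ i ≠ j := fun i hi =>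
    ⟨fun h => hS₀ (h ▸ hi), fun h => hj (h ▸ hi)⟩
  obtain ⟨c, hcU, f, hfU, hfS, hfc⟩ := exists_primitive_dual_pair hE hB hU hv hε hS
    (e := v i₀ + v j) (fun i hi => by
      simp [hv.orth, (hne i hi).1.symm, (hne i hi).2.symm]) (x := v j) (by
      simp [hv.orth, hj₀, h₁ j hj₀])
  have hee : B (c • (v i₀ + v j)) (c • (v i₀ + v j)) = 0 := by
    simp [hv.orth, hj₀, hj₀.symm, h₀, h₁ j hj₀]
  have hef : B (c • (v i₀ + v j)) f = 1 := by rw [← hB, hfc, map_one]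
  have hes : ∀ i ∈ S, B (c • (v i₀ + v j)) (v i) = 0 := fun i hi => by
    simp [hv.orth, (hne i hi).1.symm, (hne i hi).2.symm]
  generalize c • (v i₀ + v j) = e at *
  have hn := hU.int f hfU f hfU
  have ht : (1 - B f f) * w ∈ O := O.mul_mem (O.sub_mem O.one_mem hn) hE.w_mem
  have hf' : f + ((1 - B f f) * w) • e ∈ U := U.add_mem hfU (smul_mem_of_mem ht hcU)
  have hff : B (f + ((1 - B f f) * w) • e) (f + ((1 - B f f) * w) • e) = 1 := by
    simp only [map_add, map_smul, LinearMap.add_apply, LinearMap.smul_apply, smul_eq_mul,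
      map_smulₛₗ, map_mul, hB, hee, hef, hfc, map_sub, map_one]
    linear_combination (1 - B f f) * hE.w_add
  have hfs : ∀ i ∈ S, B (f + ((1 - B f f) * w) • e) (v i) = 0 := fun i hi => by
    simp [hfS i hi, hes i hi]
  obtain ⟨g, hg, hgx, hgz⟩ := exists_isometry_of_norm_one hE hB (x := v j)
    (by rw [hv.orth, if_pos rfl, h₁ j hj₀]) hff
  refine ⟨g ∘ v, hv.map hg, fun i hi => hgz _ ?_ ?_, ?_⟩
  · rw [hv.orth, if_neg (hne i hi).2]
  · rw [← hB, hfs i hi, map_zero]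
  · rw [Function.comp_apply, hgx]; exact hf'

theorem exists_system_last [CharZero K] (hE : IsEisenstein σ O τ w)
    (hB : ∀ x y, σ (B x y) = B y x) {U : Submodule O V} (hU : IsUnimodular B U)
    (hv : IsSystem B ε v) {i₀ : ι} (h₀ : ε i₀ = -1) (h₁ : ∀ i, i ≠ i₀ → ε i = 1)
    (hS : ∀ i, i ≠ i₀ → v i ∈ U) :
    ∃ v', IsSystem B ε v' ∧ (∀ i, i ≠ i₀ → v' i = v i) ∧ ∀ i, v' i ∈ U := by
  have hε : ∀ i, ε i * ε i = 1 := fun i => by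
    by_cases h : i = i₀
    · rw [h, h₀]; norm_num
    · rw [h₁ i h]; norm_num
  obtain ⟨c, hcU, f, hfU, hfS, hfc⟩ := exists_primitive_dual_pair hE hB hU hv hε
    (S := Finset.univ.erase i₀) (fun i hi => hS i (Finset.ne_of_mem_erase hi))
    (e := v i₀) (fun i hi => by simp [hv.orth, (Finset.ne_of_mem_erase hi).symm])
    (x := v i₀) (by simp [hv.orth, h₀])
  obtain ⟨y, hy⟩ : ∃ y : K, f = y • v i₀ := by
    refine ⟨_, (hv.expand f).trans (Finset.sum_eq_single i₀ (fun i _ hi => ?_) (by simp))⟩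
    rw [hfS i (by simp [hi]), mul_zero, zero_smul]
  have h1 := hU.int _ hcU _ hcU
  have h2 := hU.int _ hfU _ hfU
  simp only [hy, map_smul, LinearMap.smul_apply, smul_eq_mul, map_smulₛₗ, hv.orth, if_true,
    h₀] at h1 h2 hfc
  obtain ⟨m, hm⟩ := hE.int_of_real _ h1 (by simp only [map_mul, map_neg, map_one, hE.conj_conj]; ring)
  obtain ⟨n, hn⟩ := hE.int_of_real _ h2 (by simp only [map_mul, map_neg, map_one, hE.conj_conj]; ring)
  have hfc' := congrArg σ hfc
  simp only [map_mul, map_neg, map_one, hE.conj_conj] at hfc'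
  have hmn : m * n = 1 := by
    have : (m : K) * n = 1 := by
      rw [← hm, ← hn]
      linear_combination (c * σ y * -1) * hfc + hfc'
    exact_mod_cast this
  have hcc : c * σ c = 1 := by
    rcases Int.eq_one_or_neg_one_of_mul_eq_one hmn with rfl | rfl
    · exact absurd (by push_cast at hm; linear_combination -hm) (hE.norm_ne c)
    · push_cast at hm; linear_combination -hm
  obtain ⟨g, hg, hgx⟩ := exists_transvection hE hB (v i₀) (1 - c) (by
    rw [hv.orth, if_pos rfl, h₀, map_sub, map_one]; linear_combination -hcc)
  have hgi : ∀ i, i ≠ i₀ → g (v i) = v i := fun i hi => by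
    rw [hgx, hv.orth, if_neg hi]; simp
  refine ⟨g ∘ v, hv.map hg, hgi, fun i => ?_⟩
  by_cases hi : i = i₀
  · rw [Function.comp_apply, hi, hgx, hv.orth, if_pos rfl, h₀]
    convert hcU using 1
    module
  · rw [Function.comp_apply, hgi i hi]; exact hS i hi

/-- A unimodular lattice in a Lorentzian Hermitian space has an orthogonal basis of vectors of norm
`±1` extending any given orthonormal set of its vectors that belongs to a basis of the space. -/
theorem IsUnimodular.exists_system [CharZero K] (hE : IsEisenstein σ O τ w)
    (hB : ∀ x y, σ (B x y) = B y x) {U : Submodule O V} (hU : IsUnimodular B U)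
    (hv : IsSystem B ε v) {i₀ : ι} (h₀ : ε i₀ = -1) (h₁ : ∀ i, i ≠ i₀ → ε i = 1) {j : ι}
    (hj₀ : j ≠ i₀) (hj : v j ∈ U) :
    ∃ v', IsSystem B ε v' ∧ v' j = v j ∧ ∀ i, v' i ∈ U := by
  have key : ∀ T : Finset ι, i₀ ∉ T →
      ∃ v', IsSystem B ε v' ∧ v' j = v j ∧ ∀ i ∈ insert j T, v' i ∈ U := by
    intro T
    induction T using Finset.induction_on with
    | empty => exact fun _ => ⟨v, hv, rfl, by simpa using hj⟩
    | insert a T ha ih =>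
      intro h
      rw [Finset.mem_insert, not_or] at h
      obtain ⟨v', hv', hj', hT⟩ := ih h.2
      by_cases haj : a ∈ insert j T
      · refine ⟨v', hv', hj', ?_⟩
        rwa [Finset.insert_comm, Finset.insert_eq_of_mem haj]
      obtain ⟨v'', hv'', hS'', ha''⟩ := exists_system_insert hE hB hU hv' h₀ h₁
        (S := insert j T) (by simp [hj₀.symm, h.2]) hT haj (Ne.symm h.1)
      refine ⟨v'', hv'', by rw [hS'' j (by simp), hj'], fun i hi => ?_⟩
      rw [Finset.insert_comm, Finset.mem_insert] at hi
      rcases hi with rfl | hi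
      · exact ha''
      · rw [hS'' i hi]; exact hT i hi
  obtain ⟨v', hv', hj', hT⟩ := key (Finset.univ.erase i₀) (by simp)
  obtain ⟨v'', hv'', hS, hU''⟩ := exists_system_last hE hB hU hv' h₀ h₁
    (fun i hi => hT i (by simp [hi]))
  exact ⟨v'', hv'', by rw [hS j hj₀, hj'], hU''⟩

end System

/-- `r` is a root of norm `3` splitting off the lattice `Λ`, with `τ`-modular complement. -/
structure IsChordal (B : V →ₗ[K] V →ₛₗ[σ] K) (τ : K) (Λ : Submodule O V) (r : V) : Prop where
  mem : r ∈ Λ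
  norm : B r r = 3
  div : ∀ x ∈ Λ, ∃ a ∈ O, B x r = 3 * a
  modular : ∀ x, B x r = 0 → (∀ y ∈ Λ, ∃ a ∈ O, B x y = τ * a) → x ∈ Λ

theorem mem_of_mem_sup_span (hE : IsEisenstein σ O τ w) (hB : ∀ x y, σ (B x y) = B y x)
    {U : Submodule O V} (hU : ∀ x ∈ U, ∀ y ∈ U, B x y ∈ O) {x : V} (hx : B x x ∈ O)
    (hxU : ∀ y ∈ U, B x y ∈ O) :
    ∀ y ∈ U ⊔ Submodule.span O {x}, ∀ z ∈ U ⊔ Submodule.span O {x}, B y z ∈ O := by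
  intro y' hyU z' hzU
  obtain ⟨y, hy, _, hy', rfl⟩ := Submodule.mem_sup.1 hyU
  obtain ⟨z, hz, _, hz', rfl⟩ := Submodule.mem_sup.1 hzU
  obtain ⟨a, rfl⟩ := Submodule.mem_span_singleton.1 hy'
  obtain ⟨b, rfl⟩ := Submodule.mem_span_singleton.1 hz'
  have h1 := hU y hy z hz
  have h2 := hxU z hz
  have h3 := hE.conj_mem _ (hxU y hy)
  rw [hB] at h3
  have ha := a.2
  have hb := hE.conj_mem _ b.2
  change B (y + (a : K) • x) (z + (b : K) • x) ∈ O
  simp only [map_add, map_smul, LinearMap.add_apply, LinearMap.smul_apply, smul_eq_mul,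
    map_smulₛₗ]
  exact O.add_mem (O.add_mem h1 (O.mul_mem ha h2))
    (O.mul_mem hb (O.add_mem h3 (O.mul_mem ha hx)))

theorem IsEisenstein.theta_ne_zero [CharZero K] (hE : IsEisenstein σ O τ w) : τ ≠ 0 := by
  intro h
  have := hE.theta_sq
  rw [h] at this
  norm_num at this

theorem IsEisenstein.exists_eq_three_mul [CharZero K] (hE : IsEisenstein σ O τ w) {m : ℤ} {a : K}
    (ha : a ∈ O) (h : (m : K) = τ * a) : ∃ k : ℤ, m = 3 * k := by
  obtain ⟨n, hn⟩ := hE.int_of_real _ (O.mul_mem ha (hE.conj_mem a ha))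
    (by rw [map_mul, hE.conj_conj, mul_comm])
  have h' := congrArg σ h
  rw [map_intCast, map_mul, hE.conj_theta] at h'
  have : m * m = 3 * n := by
    have : (m : K) * m = 3 * n := by
      rw [← hn]
      linear_combination (m : K) * h' - τ * σ a * h - a * σ a * hE.theta_sq
    exact_mod_cast this
  have h3 : (3 : ℤ) ∣ m := by
    have hp : Prime (3 : ℤ) := Int.prime_three
    exact (hp.dvd_or_dvd ⟨n, this⟩).elim id id
  exact h3

theorem IsChordal.exists_isUnimodular [CharZero K] (hE : IsEisenstein σ O τ w)
    (hB : ∀ x y, σ (B x y) = B y x) {Λ : Submodule O V}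
    (hΛ : ∀ x ∈ Λ, ∀ y ∈ Λ, ∃ a ∈ O, B x y = τ * a)
    (hfull : ∀ x : V, ∃ d ∈ O, d ≠ 0 ∧ d • x ∈ Λ) {r : V} (hr : IsChordal B τ Λ r) :
    ∃ U : Submodule O V, IsUnimodular B U ∧ Λ ≤ U ∧ τ⁻¹ • r ∈ U := by
  have hτ := hE.theta_ne_zero
  have h3 : σ τ⁻¹ = -τ⁻¹ := by rw [map_inv₀, hE.conj_theta, inv_neg]
  have hτi : τ⁻¹ * 3 = -τ := by field_simp; linear_combination hE.theta_sq
  let P : Set (Submodule O V) := {U | ∀ x ∈ U, ∀ y ∈ U, B x y ∈ O}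
  have h0 : Λ ⊔ Submodule.span O {τ⁻¹ • r} ∈ P := by
    refine mem_of_mem_sup_span hE hB (fun x hx y hy => ?_) ?_ (fun y hy => ?_)
    · obtain ⟨a, ha, h⟩ := hΛ x hx y hy
      exact h ▸ O.mul_mem hE.theta_mem ha
    · simp only [map_smul, LinearMap.smul_apply, smul_eq_mul, map_smulₛₗ, h3, hr.norm, hτi]
      rw [neg_mul_neg, inv_mul_cancel₀ hτ]
      exact O.one_mem
    · obtain ⟨a, ha, h⟩ := hr.div y hy
      rw [map_smul, LinearMap.smul_apply, ← hB, h, smul_eq_mul, map_mul, map_ofNat, ← mul_assoc, hτi]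
      exact O.mul_mem (O.neg_mem hE.theta_mem) (hE.conj_mem _ ha)
  obtain ⟨U, hle, hU⟩ := zorn_le_nonempty₀ P (fun c hc hch y hy => by
    refine ⟨sSup c, fun x hx z hz => ?_, fun z hz => le_sSup hz⟩
    rw [Submodule.mem_sSup_of_directed ⟨y, hy⟩ hch.directedOn] at hx hz
    obtain ⟨X, hX, hx⟩ := hx
    obtain ⟨Z, hZ, hz⟩ := hz
    rcases hch.total hX hZ with h | h
    · exact hc hZ x (h hx) z hz
    · exact hc hX x hx z (h hz)) _ h0
  have hΛU : Λ ≤ U := le_sup_left.trans hle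
  have hrU : τ⁻¹ • r ∈ U := hle (Submodule.mem_sup_right (Submodule.mem_span_singleton_self _))
  refine ⟨U, ⟨hU.prop, fun x hx => ?_, fun x => ?_⟩, hΛU, hrU⟩
  · have hb := hx _ hrU
    obtain ⟨b, hbx⟩ : ∃ b, b = B x (τ⁻¹ • r) := ⟨_, rfl⟩
    rw [← hbx] at hb
    have hxr : B x r = -τ * b := by
      rw [hbx, map_smulₛₗ, h3, smul_eq_mul]; field_simp
    obtain ⟨l, hl⟩ : ∃ l, l = x - b • τ⁻¹ • r := ⟨_, rfl⟩
    have hlr : B l r = 0 := by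
      rw [hl, map_sub, LinearMap.sub_apply, map_smul, map_smul, LinearMap.smul_apply,
        LinearMap.smul_apply, hr.norm, hxr, smul_eq_mul, smul_eq_mul, hτi]
      ring
    have hlU : ∀ y ∈ U, B l y ∈ O := fun y hy => by
      rw [hl, map_sub, LinearMap.sub_apply, map_smul, LinearMap.smul_apply]
      exact O.sub_mem (hx y hy) (O.mul_mem hb (hU.prop _ hrU _ hy))
    have hlΛ : τ • l ∈ Λ := hr.modular _ (by simp [hlr]) fun y hy =>
      ⟨B l y, hlU y (hΛU hy), by simp⟩
    obtain ⟨m, hm⟩ := hE.int_of_real (B l (τ • l)  * τ) (O.mul_mem (hlU _ (hΛU hlΛ)) hE.theta_mem) (by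
      simp only [map_smulₛₗ, smul_eq_mul, map_mul, hE.conj_theta, map_neg, hB]; ring)
    obtain ⟨k, rfl⟩ := hE.exists_eq_three_mul (hlU _ (hΛU hlΛ)) (by rw [← hm, mul_comm])
    have hll : B l l = k := by
      rw [map_smulₛₗ, hE.conj_theta, smul_eq_mul] at hm
      push_cast at hm
      have : (3 : K) ≠ 0 := by norm_num
      apply mul_left_cancel₀ this
      linear_combination hm + B l l * hE.theta_sq
    have hxx : B x x ∈ O := by
      have : B x x = b * σ b + B l l := by
        have hx' : x = l + b • τ⁻¹ • r := by rw [hl]; module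
        have hrl : B r l = 0 := by rw [← hB, hlr, map_zero]
        rw [hx']
        simp only [map_add, map_smul, LinearMap.add_apply, LinearMap.smul_apply, smul_eq_mul,
          map_smulₛₗ, hrl, hlr, hr.norm, h3, hτi]
        field_simp
        ring
      rw [this, hll]
      exact O.add_mem (O.mul_mem hb (hE.conj_mem b hb)) (intCast_mem O k)
    have := hU.le_of_ge (mem_of_mem_sup_span hE hB hU.prop hxx hx) le_sup_left
    exact this (Submodule.mem_sup_right (Submodule.mem_span_singleton_self _))
  · obtain ⟨d, hd, hd0, hdx⟩ := hfull x
    exact ⟨d, hd, hd0, hΛU hdx⟩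

/-- In a unimodular lattice containing an isotropic `e` and `f` with `⟨f, e⟩ = 1`, an element whose
norm is not divisible by `τ` is congruent modulo `τ` to an element of norm `±1`. -/
theorem exists_norm_eq_one_or_neg_one [CharZero K] (hE : IsEisenstein σ O τ w)
    (hB : ∀ x y, σ (B x y) = B y x) {U : Submodule O V} (hU : ∀ x ∈ U, ∀ y ∈ U, B x y ∈ O)
    {e f s : V} (heU : e ∈ U) (hfU : f ∈ U) (hee : B e e = 0) (hfe : B f e = 1)
    (hes : B e s = 0) (hfs : B f s = 0) {x : V} (hx : x ∈ U)
    (hxx : ¬ ∃ a ∈ O, B x x = τ * a) :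
    ∃ z ∈ U, B z s = 0 ∧ (B (x + τ • z) (x + τ • z) = 1 ∨ B (x + τ • z) (x + τ • z) = -1) := by
  obtain ⟨k, hk, hα⟩ : ∃ k ∈ O, B (x + τ • k • f) e = 1 ∨ B (x + τ • k • f) e = -1 ∨
      B (x + τ • k • f) e = τ := by
    obtain ⟨y, hy, h⟩ := hE.residue _ (hU x hx e heU)
    rcases h with h | h | h
    · exact ⟨1 - y, O.sub_mem O.one_mem hy, Or.inr (Or.inr (by simp [h, hfe]; ring))⟩
    · exact ⟨-y, O.neg_mem hy, Or.inl (by simp [h, hfe])⟩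
    · exact ⟨-y, O.neg_mem hy, Or.inr (Or.inl (by simp [h, hfe]))⟩
  have hkf : k • f ∈ U := smul_mem_of_mem hk hfU
  have hu : x + τ • k • f ∈ U := U.add_mem hx (smul_mem_of_mem hE.theta_mem hkf)
  have huu : ¬ ∃ a ∈ O, B (x + τ • k • f) (x + τ • k • f) = τ * a := by
    rintro ⟨a, ha, h⟩
    refine hxx ⟨a - B (k • f) x + B x (k • f) + τ * B (k • f) (k • f), ?_, ?_⟩
    · exact O.add_mem (O.add_mem (O.sub_mem ha (hU _ hkf _ hx)) (hU _ hx _ hkf))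
        (O.mul_mem hE.theta_mem (hU _ hkf _ hkf))
    · simp only [map_add, map_smul _ τ, LinearMap.add_apply, LinearMap.smul_apply, smul_eq_mul,
        map_smulₛₗ _ τ, hE.conj_theta] at h
      linear_combination h
  obtain ⟨u, hu'⟩ : ∃ u, u = x + τ • k • f := ⟨_, rfl⟩
  rw [← hu'] at hu huu hα
  have hnorm : ∃ n : K, (n = 1 ∨ n = -1) ∧ ∃ m : ℤ, n = B u u + 3 * m := by
    obtain ⟨m, hm⟩ := hE.int_of_real _ (hU u hu u hu) (hB u u)
    have h3 : ¬ (3 : ℤ) ∣ m := by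
      rintro ⟨k, rfl⟩
      refine huu ⟨-τ * k, O.mul_mem (O.neg_mem hE.theta_mem) (intCast_mem O k), ?_⟩
      rw [hm]; push_cast
      linear_combination k * hE.theta_sq
    have : m % 3 = 1 ∨ m % 3 = 2 := by omega
    rcases this with h | h
    · refine ⟨1, Or.inl rfl, -(m / 3), ?_⟩
      have : m = 1 + 3 * (m / 3) := by omega
      rw [hm]; nth_rewrite 1 [this]; push_cast; ring
    · refine ⟨-1, Or.inr rfl, -(m / 3 + 1), ?_⟩
      have : m = -1 + 3 * (m / 3 + 1) := by omega
      rw [hm]; nth_rewrite 1 [this]; push_cast; ring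
  obtain ⟨n, hn, m, hm⟩ := hnorm
  obtain ⟨t, ht, htm⟩ : ∃ t ∈ O, τ * t * σ (B u e) + σ (τ * t * σ (B u e)) = 3 * m := by
    have hm' := intCast_mem O m
    have hwθ : τ * (σ w - w) = -3 := by rw [hE.w_sub, hE.theta_sq]
    rcases hα with h | h | h
    · refine ⟨-(m * σ w), O.neg_mem (O.mul_mem hm' (hE.conj_mem _ hE.w_mem)), ?_⟩
      rw [h]
      simp only [map_mul, map_one, hE.conj_theta, map_neg, map_intCast, hE.conj_conj]
      linear_combination (-m : K) * hwθ
    · refine ⟨m * σ w, O.mul_mem hm' (hE.conj_mem _ hE.w_mem), ?_⟩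
      rw [h]
      simp only [map_mul, map_one, hE.conj_theta, map_neg, map_intCast, hE.conj_conj]
      linear_combination (-m : K) * hwθ
    · refine ⟨m * w, O.mul_mem hm' hE.w_mem, ?_⟩
      rw [h]
      simp only [map_mul, hE.conj_theta, map_neg, map_intCast]
      linear_combination 3 * (m : K) * hE.w_add - (m : K) * (w + σ w) * hE.theta_sq
  have heu : B e u = σ (B u e) := (hB u e).symm
  refine ⟨k • f + t • e, U.add_mem hkf (smul_mem_of_mem ht heU), by simp [hes, hfs], ?_⟩
  have : x + τ • (k • f + t • e) = u + (τ * t) • e := by rw [hu']; module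
  rw [this]
  have : B (u + (τ * t) • e) (u + (τ * t) • e) = n := by
    simp only [map_add, map_smul, LinearMap.add_apply, LinearMap.smul_apply, smul_eq_mul,
      map_smulₛₗ, hee, heu]
    rw [hm, ← htm]
    simp only [map_mul, hE.conj_conj]
    ring
  rwa [this]

theorem IsChordal.exists_system [CharZero K] [Fintype ι] [DecidableEq ι] (hE : IsEisenstein σ O τ w)
    (hB : ∀ x y, σ (B x y) = B y x) {Λ : Submodule O V}
    (hΛ : ∀ x ∈ Λ, ∀ y ∈ Λ, ∃ a ∈ O, B x y = τ * a)
    (hfull : ∀ x : V, ∃ d ∈ O, d ≠ 0 ∧ d • x ∈ Λ) {ε : ι → K} {v : ι → V} (hv : IsSystem B ε v)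
    {i₀ : ι} (h₀ : ε i₀ = -1) (h₁ : ∀ i, i ≠ i₀ → ε i = 1) {j : ι} (hj₀ : j ≠ i₀) {r : V}
    (hr : IsChordal B τ Λ r) :
    ∃ (U : Submodule O V) (v' : ι → V), (∀ x ∈ U, ∀ y ∈ U, B x y ∈ O) ∧ Λ ≤ U ∧
      IsSystem B ε v' ∧ τ • v' j = r ∧ ∀ i, v' i ∈ U := by
  have hτ := hE.theta_ne_zero
  obtain ⟨U, hU, hΛU, hrU⟩ := hr.exists_isUnimodular hE hB hΛ hfull
  obtain ⟨g, hg, hgj, -⟩ := exists_isometry_of_norm_one hE hB (x := v j) (y := τ⁻¹ • r)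
    (by rw [hv.orth, if_pos rfl, h₁ j hj₀]) (by
      simp only [map_smul, LinearMap.smul_apply, smul_eq_mul, map_smulₛₗ, map_inv₀, hE.conj_theta,
        hr.norm]
      field_simp
      linear_combination -hE.theta_sq)
  obtain ⟨v', hv', hj', hU'⟩ := hU.exists_system hE hB (hv.map hg) h₀ h₁ hj₀ 
    (by rwa [Function.comp_apply, hgj])
  refine ⟨U, v', hU.int, hΛU, hv', ?_, hU'⟩
  rw [hj', Function.comp_apply, hgj, smul_inv_smul₀ hτ]

theorem IsSystem.exists_isometry_mem_iff [Fintype ι] [DecidableEq ι] {ε : ι → K}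
    (hε : ∀ i, ε i * ε i = 1) {v v' : ι → V} (hv : IsSystem B ε v) (hv' : IsSystem B ε v')
    {U U' : Submodule O V} (hU : ∀ x ∈ U, ∀ y ∈ U, B x y ∈ O)
    (hU' : ∀ x ∈ U', ∀ y ∈ U', B x y ∈ O) (hvU : ∀ i, v i ∈ U) (hvU' : ∀ i, v' i ∈ U') :
    ∃ g : V ≃ₗ[K] V, IsIsometry B g ∧ (∀ i, g (v i) = v' i) ∧ ∀ x, x ∈ U ↔ g x ∈ U' := by
  obtain ⟨g, hg, hgx⟩ := hv.exists_isometry hε hv'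
  have hgv : ∀ i, g (v i) = v' i := fun i => by
    simp only [hgx, hv.orth, mul_ite, mul_zero, ite_smul, zero_smul]
    simp [hε]
  have hεO : ∀ i, ε i ∈ O := fun i => by
    have := hU _ (hvU i) _ (hvU i)
    rwa [hv.orth, if_pos rfl] at this
  refine ⟨g, hg, hgv, fun x => ⟨fun hx => ?_, fun hx => ?_⟩⟩
  · rw [hgx]
    exact U'.sum_mem fun i _ =>
      smul_mem_of_mem (O.mul_mem (hεO i) (hU _ hx _ (hvU i))) (hvU' i)
  · rw [hv.expand x]
    refine U.sum_mem fun i _ => smul_mem_of_mem (O.mul_mem (hεO i) ?_) (hvU i)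
    rw [← hg, hgv]
    exact hU' _ hx _ (hvU' i)

theorem IsEisenstein.exists_conj_eq (hE : IsEisenstein σ O τ w) {x : K} (hx : x ∈ O) :
    ∃ a ∈ O, σ x = x + τ * a := by
  obtain ⟨y, hy, h⟩ := hE.residue x hx
  refine ⟨-σ y - y, O.sub_mem (O.neg_mem (hE.conj_mem y hy)) hy, ?_⟩
  rcases h with rfl | rfl | rfl <;> simp [hE.conj_theta] <;> ring

/-- The isometry `G`, which matches the unimodular lattices `U` and `U'`, can be modified so that
the preimages of finitely many given vectors of `Λ` orthogonal to `s` lie in `Λ`. -/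
theorem IsChordal.exists_isometry_finset [CharZero K] (hE : IsEisenstein σ O τ w)
    (hB : ∀ x y, σ (B x y) = B y x) {Λ U U' : Submodule O V}
    (hΛ : ∀ x ∈ Λ, ∀ y ∈ Λ, ∃ a ∈ O, B x y = τ * a)
    (hU : ∀ x ∈ U, ∀ y ∈ U, B x y ∈ O) (hU' : ∀ x ∈ U', ∀ y ∈ U', B x y ∈ O)
    (hΛU : Λ ≤ U) (hΛU' : Λ ≤ U') {r s e f : V} (hr : IsChordal B τ Λ r)
    (heU : e ∈ U') (hfU : f ∈ U') (hee : B e e = 0) (hfe : B f e = 1)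
    (hes : B e s = 0) (hfs : B f s = 0)
    (hG : ∃ G : V ≃ₗ[K] V, IsIsometry B G ∧ G r = s ∧ ∀ x, x ∈ U ↔ G x ∈ U') (T : Finset V)
    (hT : ∀ y ∈ T, y ∈ Λ ∧ B y s = 0) :
    ∃ G : V ≃ₗ[K] V, IsIsometry B G ∧ G r = s ∧ (∀ x, x ∈ U ↔ G x ∈ U') ∧
      ∀ y ∈ T, G.symm y ∈ Λ := by
  have hθ := hE.theta_sq
  have hp : ∀ p ∈ U, B p r = 0 → τ • p ∈ Λ := fun p hp hpr =>
    hr.modular _ (by simp [hpr]) fun y hy => ⟨B p y, hU _ hp _ (hΛU hy), by simp⟩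
  classical
  induction T using Finset.induction_on with
  | empty =>
    obtain ⟨G, h1, h2, h3⟩ := hG
    exact ⟨G, h1, h2, h3, by simp⟩
  | insert y T _ ih =>
    obtain ⟨G, hG, hGr, hGU, hGT⟩ := ih fun t ht => hT t (Finset.mem_insert_of_mem ht)
    by_cases hyG : G.symm y ∈ Λ
    · exact ⟨G, hG, hGr, hGU, by simpa using ⟨hyG, hGT⟩⟩
    obtain ⟨hyΛ, hys⟩ := hT y (Finset.mem_insert_self _ _)
    have hyr : B (G.symm y) r = 0 := by rw [hG.apply_symm, hGr, hys]
    obtain ⟨x', hx', hβ⟩ : ∃ x' ∈ Λ, ¬ ∃ a ∈ O, B (G.symm y) x' = τ * a := by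
      by_contra! h
      exact hyG (hr.modular _ hyr fun t ht => by
        by_contra h'
        exact h' (by simpa using h t ht))
    obtain ⟨a, ha, hax⟩ := hr.div x' hx'
    obtain ⟨x'', hx''⟩ : ∃ x'', x'' = x' - a • r := ⟨_, rfl⟩
    have hxΛ : x'' ∈ Λ := hx'' ▸ Λ.sub_mem hx' (smul_mem_of_mem ha hr.mem)
    have hxr : B x'' r = 0 := by
      simp only [hx'', map_sub, LinearMap.sub_apply, map_smul, LinearMap.smul_apply, hax, hr.norm,
        smul_eq_mul]
      ring
    rw [show B (G.symm y) x' = B (G.symm y) x'' by simp [hx'', hyr], hG.apply_symm] at hβ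
    obtain ⟨x, hx⟩ : ∃ x, x = G x'' := ⟨_, rfl⟩
    rw [← hx] at hβ
    have hxU : x ∈ U' := hx ▸ (hGU _).1 (hΛU hxΛ)
    have hyU := hΛU' hyΛ
    have hxs : B x s = 0 := by rw [hx, ← hGr, hG, hxr]
    obtain ⟨p, hpO, hxx⟩ := hΛ _ hxΛ _ hxΛ
    rw [← hG x'' x'', ← hx] at hxx
    obtain ⟨q, hqO, hyy⟩ := hΛ _ hyΛ _ hyΛ
    obtain ⟨b, hb, hyx⟩ := hE.exists_conj_eq (hU' _ hyU _ hxU)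
    rw [hB] at hyx
    have hxy : ¬ ∃ a ∈ O, B (x - y) (x - y) = τ * a := by
      rintro ⟨c, hc, h⟩
      refine hβ ⟨c - p - q + b - τ * B y x, O.sub_mem (O.add_mem (O.sub_mem (O.sub_mem hc hpO) hqO)
        hb) (O.mul_mem hE.theta_mem (hU' _ hyU _ hxU)), ?_⟩
      simp only [map_sub, LinearMap.sub_apply] at h
      linear_combination h - hxx - hyy + hyx + B y x * hθ
    obtain ⟨z, hz, hzs, hn⟩ := exists_norm_eq_one_or_neg_one hE hB hU' heU hfU hee hfe hes hfs
      (U'.sub_mem hxU hyU) hxy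
    obtain ⟨u, hu⟩ : ∃ u, u = x - y + τ • z := ⟨_, rfl⟩
    obtain ⟨n, hnu⟩ : ∃ n, n = B u u := ⟨_, rfl⟩
    rw [← hu, ← hnu] at hn
    have hnn : n * n = 1 := by rcases hn with rfl | rfl <;> norm_num
    have hσn : σ n = n := by rw [hnu, hB]
    have huU : u ∈ U' :=
      hu ▸ U'.add_mem (U'.sub_mem hxU hyU) (smul_mem_of_mem hE.theta_mem hz)
    have hus : B u s = 0 := by simp [hu, hxs, hys, hzs]
    have hnO : n ∈ O := hnu ▸ hU' _ huU _ huU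
    have h2O : -2 * n ∈ O := O.mul_mem (O.neg_mem (by exact_mod_cast natCast_mem O 2)) hnO
    obtain ⟨g, hg, hgx⟩ := exists_transvection hE hB u (-2 * n) (by
      rw [← hnu, map_mul, hσn, map_neg, map_ofNat]
      linear_combination 4 * n * hnn)
    have hgg : ∀ t, g (g t) = t := fun t => by
      rw [hgx (g t), hgx t]
      simp only [map_add, map_smul, LinearMap.add_apply, LinearMap.smul_apply, smul_eq_mul, ← hnu]
      rw [add_assoc, ← add_smul, show -2 * n * B t u + -2 * n * (B t u + -2 * n * B t u * n) = 0 by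
        linear_combination 4 * n * B t u * hnn, zero_smul, add_zero]
    have hgU : ∀ t ∈ U', g t ∈ U' := fun t ht => by
      rw [hgx]
      exact U'.add_mem ht (smul_mem_of_mem (O.mul_mem h2O (hU' _ ht _ huU)) huU)
    have hgs : g s = s := by rw [hgx, ← hB, hus]; simp
    have hgsymm : ∀ t, g.symm t = g t := fun t => by rw [LinearEquiv.symm_apply_eq, hgg]
    have hmem : ∀ t ∈ U', B t s = 0 → τ • G.symm t ∈ Λ := fun t ht hts =>
      hp _ ((hGU _).2 (by simpa using ht)) (by rw [hG.apply_symm, hGr, hts])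
    refine ⟨G.trans g, hG.trans hg, by simp [hGr, hgs], fun t => ?_, fun t ht => ?_⟩
    · rw [hGU, LinearEquiv.trans_apply]
      exact ⟨hgU _, fun h => hgg (G t) ▸ hgU _ h⟩
    · rw [LinearEquiv.symm_trans_apply, hgsymm, hgx]
      have key : ∀ k ∈ O, B (k • u) s = 0 ∧ k • u ∈ U' := fun k hk =>
        ⟨by simp [hus], smul_mem_of_mem hk huU⟩
      have hzc := hU' _ hyU _ hz
      rcases Finset.mem_insert.1 ht with rfl | ht
      · obtain ⟨k, hk, hBk⟩ : ∃ k ∈ O, B t u = n + τ * k := by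
          have hnu' := hnu
          have hzu := hU' _ hz _ huU
          have hxz := hU' _ hxU _ hz
          have hyxO := hU' _ hyU _ hxU
          refine ⟨b - p - 2 * q - 2 * B t z + B x z - B z u - τ * B t x, ?_, ?_⟩
          · exact O.sub_mem (O.sub_mem (O.add_mem (O.sub_mem (O.sub_mem (O.sub_mem hb hpO)
              (O.mul_mem (by exact_mod_cast natCast_mem O 2) hqO))
              (O.mul_mem (by exact_mod_cast natCast_mem O 2) hzc)) hxz) hzu)
              (O.mul_mem hE.theta_mem hyxO)
          · have hz' : B z u = B z u := rfl
            rw [hnu]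
            have h1 : B u u = B x u - B t u + τ * B z u := by
              conv_lhs => rw [hu]
              simp [hu]
            have h2 : B x u = B x x - B x t - τ * B x z := by
              simp [hu, hE.conj_theta]; ring
            have h3 : B t u = B t x - B t t - τ * B t z := by
              simp [hu, hE.conj_theta]; ring
            linear_combination 2 * h3 - h1 - h2 - hxx - 2 * hyy + hyx + B t x * hθ
        have : t + (-2 * n * B t u) • u = x + τ • (z + (τ - 2 * n * k) • u) := by
          rw [hBk, show -2 * n * (n + τ * k) = 1 + τ * (τ - 2 * n * k) by
            linear_combination -2 * hnn - hθ]
          rw [show (1 + τ * (τ - 2 * n * k)) • u = u + τ • (τ - 2 * n * k) • u by module]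
          nth_rewrite 1 [hu]
          module
        have hk' := key (τ - 2 * n * k) (by
          rw [show τ - 2 * n * k = τ + -2 * n * k by ring]
          exact O.add_mem hE.theta_mem (O.mul_mem h2O hk))
        rw [this, map_add, map_smul, hx, G.symm_apply_apply]
        exact Λ.add_mem hxΛ (hmem _ (U'.add_mem hz hk'.2) (by
          rw [map_add, LinearMap.add_apply, hzs, hk'.1, add_zero]))
      · obtain ⟨htΛ, hts⟩ := hT t (Finset.mem_insert_of_mem ht)
        obtain ⟨c, hc, htx⟩ := hΛ _ (hGT t ht) _ hxΛ
        rw [hG.apply_symm, ← hx] at htx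
        obtain ⟨d, hd, hty⟩ := hΛ _ htΛ _ hyΛ
        have htu : B t u = τ * (c - d - B t z) := by
          simp [hu, hE.conj_theta, htx, hty]; ring
        have hk' := key (-2 * n * (c - d - B t z)) (O.mul_mem h2O
          (O.sub_mem (O.sub_mem hc hd) (hU' _ (hΛU' htΛ) _ hz)))
        rw [htu, map_add, show (-2 * n * (τ * (c - d - B t z))) • u =
          τ • (-2 * n * (c - d - B t z)) • u by module, map_smul]
        exact Λ.add_mem (hGT t ht) (hmem _ hk'.2 hk'.1)

/-- Chordal roots of a finitely generated lattice are equivalent under its isometries. -/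
theorem IsChordal.exists_isometry [CharZero K] [Fintype ι] [DecidableEq ι]
    (hE : IsEisenstein σ O τ w) (hB : ∀ x y, σ (B x y) = B y x) {Λ : Submodule O V} (hfg : Λ.FG)
    (hΛ : ∀ x ∈ Λ, ∀ y ∈ Λ, ∃ a ∈ O, B x y = τ * a)
    (hfull : ∀ x : V, ∃ d ∈ O, d ≠ 0 ∧ d • x ∈ Λ) {ε : ι → K} {v : ι → V} (hv : IsSystem B ε v)
    {i₀ : ι} (h₀ : ε i₀ = -1) (h₁ : ∀ i, i ≠ i₀ → ε i = 1) {j k : ι} (hj₀ : j ≠ i₀) (hk₀ : k ≠ i₀)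
    (hkj : k ≠ j) {r s : V} (hr : IsChordal B τ Λ r) (hs : IsChordal B τ Λ s) :
    ∃ G : V ≃ₗ[K] V, IsIsometry B G ∧ G r = s ∧ ∀ x, x ∈ Λ ↔ G x ∈ Λ := by
  have hε : ∀ i, ε i * ε i = 1 := fun i => by
    by_cases h : i = i₀
    · rw [h, h₀]; norm_num
    · rw [h₁ i h]; norm_num
  obtain ⟨U, v₁, hU, hΛU, hv₁, hr₁, hvU⟩ := hr.exists_system hE hB hΛ hfull hv h₀ h₁ hj₀
  obtain ⟨U', v₂, hU', hΛU', hv₂, hs₂, hvU'⟩ := hs.exists_system hE hB hΛ hfull hv h₀ h₁ hj₀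
  obtain ⟨g, hg, hgv, hgU⟩ := hv₁.exists_isometry_mem_iff hε hv₂ hU hU' hvU hvU'
  obtain ⟨T, hT⟩ := hfg
  have hproj : ∀ t : V, IsChordal B τ Λ t → ∀ x ∈ Λ, ∃ a ∈ O, x - (B x t / 3) • t ∈ Λ ∧
      B x t / 3 = a ∧ B (x - (B x t / 3) • t) t = 0 := by
    intro t ht x hx
    obtain ⟨a, ha, h⟩ := ht.div x hx
    have h3 : (3 : K) ≠ 0 := by norm_num
    have : B x t / 3 = a := by rw [h]; field_simp
    refine ⟨a, ha, this ▸ Λ.sub_mem hx (smul_mem_of_mem ha ht.mem), this, ?_⟩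
    simp only [map_sub, LinearMap.sub_apply, map_smul, LinearMap.smul_apply, ht.norm, smul_eq_mul]
    field_simp
    ring
  classical
  obtain ⟨G, hG, hGr, -, hGT⟩ := hr.exists_isometry_finset hE hB hΛ hU hU' hΛU hΛU'
    (e := v₂ i₀ + v₂ k) (f := v₂ k) (s := s)
    (U'.add_mem (hvU' _) (hvU' _)) (hvU' _)
    (by simp [hv₂.orth, hk₀, hk₀.symm, h₀, h₁ k hk₀])
    (by simp [hv₂.orth, hk₀, h₁ k hk₀])
    (by simp [← hs₂, hv₂.orth, hkj, hj₀.symm])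
    (by simp [← hs₂, hv₂.orth, hkj]) ⟨g, hg, by rw [← hr₁, map_smul, hgv, hs₂], hgU⟩
    (T.image fun x => x - (B x s / 3) • s) (by
      intro y hy
      obtain ⟨x, hx, rfl⟩ := Finset.mem_image.1 hy
      obtain ⟨a, -, h1, -, h2⟩ := hproj s hs x (hT ▸ Submodule.subset_span hx)
      exact ⟨h1, h2⟩)
  have hsymm : ∀ x ∈ Λ, G.symm x ∈ Λ := by
    intro x hx
    rw [← hT] at hx
    induction hx using Submodule.span_induction with
    | mem x hx =>
      obtain ⟨a, ha, -, h, -⟩ := hproj s hs x (hT ▸ Submodule.subset_span hx)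
      have h1 := hGT _ (Finset.mem_image_of_mem _ hx)
      have h2 := Λ.add_mem h1 (smul_mem_of_mem ha hr.mem)
      rwa [map_sub, map_smul, h, G.symm_apply_eq.2 hGr.symm, sub_add_cancel] at h2
    | zero => simp
    | add x y _ _ hx hy => rw [map_add]; exact Λ.add_mem hx hy
    | smul a x _ hx =>
      change G.symm ((a : K) • x) ∈ Λ
      rw [map_smul]
      exact smul_mem_of_mem a.2 hx
  refine ⟨G, hG, hGr, fun x => ⟨fun hx => ?_, fun hx => by simpa using hsymm _ hx⟩⟩
  obtain ⟨a, ha, h1, h, h2⟩ := hproj r hr x hx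
  have h3 : G (x - (B x r / 3) • r) ∈ Λ := by
    refine hs.modular _ (by rw [← hGr, hG, h2]) fun y hy => ?_
    rw [← G.apply_symm_apply y, hG]
    exact hΛ _ h1 _ (hsymm y hy)
  have h4 := Λ.add_mem h3 (smul_mem_of_mem ha hs.mem)
  rwa [map_sub, map_smul, h, hGr, sub_add_cancel] at h4

theorem isSystem_of_card_eq_finrank [FiniteDimensional K V] [Fintype ι] [DecidableEq ι]
    {ε : ι → K} {v : ι → V}
    (horth : ∀ i j, B (v i) (v j) = if i = j then ε i else 0) (hε : ∀ i, ε i * ε i = 1)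
    (hcard : Fintype.card ι = Module.finrank K V) : IsSystem B ε v := by
  have hcoef : ∀ (c : ι → K) j, B (∑ i, c i • v i) (v j) = c j * ε j := by
    intro c j
    simp [horth]
  have hli : LinearIndependent K v := by
    rw [Fintype.linearIndependent_iff]
    intro c hc j
    have := hcoef c j
    rw [hc, map_zero, LinearMap.zero_apply] at this
    linear_combination -c j * hε j - ε j * this
  refine ⟨horth, fun x => ?_⟩
  have hspan := hli.span_eq_top_of_card_eq_finrank' hcard
  obtain ⟨c, rfl⟩ := (Submodule.mem_span_range_iff_exists_fun K).1
    (hspan ▸ Submodule.mem_top : x ∈ Submodule.span K (Set.range v))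
  refine Finset.sum_congr rfl fun i _ => ?_
  rw [hcoef]
  congr 1
  linear_combination -c i * hε i

/-- The form of `Λ` over `K`, written out in coordinates. -/
def gramForm (σ : K →+* K) (τ : K) : (Fin 11 → K) →ₗ[K] (Fin 11 → K) →ₛₗ[σ] K :=
  LinearMap.mk₂'ₛₗ (RingHom.id K) σ
    (fun x y => 3 * x 0 * σ (y 0) +
      (3 * x 1 * σ (y 1) + 3 * x 2 * σ (y 2) + 3 * x 3 * σ (y 3) + 3 * x 4 * σ (y 4) +
        τ * (x 1 * σ (y 2) + x 2 * σ (y 3) + x 3 * σ (y 4)) -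
        τ * (x 2 * σ (y 1) + x 3 * σ (y 2) + x 4 * σ (y 3))) +
      (3 * x 5 * σ (y 5) + 3 * x 6 * σ (y 6) + 3 * x 7 * σ (y 7) + 3 * x 8 * σ (y 8) +
        τ * (x 5 * σ (y 6) + x 6 * σ (y 7) + x 7 * σ (y 8)) -
        τ * (x 6 * σ (y 5) + x 7 * σ (y 6) + x 8 * σ (y 7))) +
      τ * (x 9 * σ (y 10) - x 10 * σ (y 9)))
    (fun _ _ _ => by simp only [Pi.add_apply]; ring)
    (fun _ _ _ => by simp only [Pi.smul_apply, smul_eq_mul, RingHom.id_apply]; ring)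
    (fun _ _ _ => by simp only [Pi.add_apply, map_add]; ring)
    (fun _ _ _ => by simp only [Pi.smul_apply, smul_eq_mul, map_mul]; ring)

theorem gramForm_apply (x y : Fin 11 → K) : gramForm σ τ x y = 3 * x 0 * σ (y 0) +
      (3 * x 1 * σ (y 1) + 3 * x 2 * σ (y 2) + 3 * x 3 * σ (y 3) + 3 * x 4 * σ (y 4) +
        τ * (x 1 * σ (y 2) + x 2 * σ (y 3) + x 3 * σ (y 4)) -
        τ * (x 2 * σ (y 1) + x 3 * σ (y 2) + x 4 * σ (y 3))) +
      (3 * x 5 * σ (y 5) + 3 * x 6 * σ (y 6) + 3 * x 7 * σ (y 7) + 3 * x 8 * σ (y 8) +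
        τ * (x 5 * σ (y 6) + x 6 * σ (y 7) + x 7 * σ (y 8)) -
        τ * (x 6 * σ (y 5) + x 7 * σ (y 6) + x 8 * σ (y 7))) +
      τ * (x 9 * σ (y 10) - x 10 * σ (y 9)) := rfl

theorem conj_gramForm (hE : IsEisenstein σ O τ w) (x y : Fin 11 → K) :
    σ (gramForm σ τ x y) = gramForm σ τ y x := by
  simp only [gramForm_apply, map_add, map_sub, map_mul, map_ofNat, hE.conj_conj, hE.conj_theta]
  ring

/-- An orthonormal frame of signature `(10, 1)` for `gramForm`. -/
def gramFrame (τ w : K) : Fin 11 → Fin 11 → K :=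
  ![![-τ / 3, 0, 0, 0, 0, 0, 0, 0, 0, 0, 0],
    ![0, -τ / 3, 0, 0, 0, 0, 0, 0, 0, 0, 0],
    ![0, 0, 0, -τ / 3, 0, 0, 0, 0, 0, 0, 0],
    ![0, τ / 3, 1, -τ / 3, 0, 0, 0, 0, 0, 0, 0],
    ![0, τ / 3, 1, -2 * τ / 3, -1, 0, 0, 0, 0, 0, 0],
    ![0, 0, 0, 0, 0, -τ / 3, 0, 0, 0, 0, 0],
    ![0, 0, 0, 0, 0, 0, 0, -τ / 3, 0, 0, 0],
    ![0, 0, 0, 0, 0, τ / 3, 1, -τ / 3, 0, 0, 0],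
    ![0, 0, 0, 0, 0, τ / 3, 1, -2 * τ / 3, -1, 0, 0],
    ![0, 0, 0, 0, 0, 0, 0, 0, 0, w, τ / 3],
    ![0, 0, 0, 0, 0, 0, 0, 0, 0, w - 1, τ / 3]]

set_option maxHeartbeats 4000000 in
theorem isSystem_gramFrame [CharZero K] (hE : IsEisenstein σ O τ w) :
    IsSystem (gramForm σ τ) (fun i => if i = 10 then -1 else 1) (gramFrame τ w) := by
  have hw : σ w = 1 - w := by rw [← hE.w_add]; ring
  have hτ := hE.theta_sq
  have h3 : (3 : K) ≠ 0 := by norm_num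
  have hσ3 : σ 3 = 3 := map_ofNat σ 3
  have hσ2 : σ 2 = 2 := map_ofNat σ 2
  refine isSystem_of_card_eq_finrank (fun i j => ?_) (fun i => by split_ifs <;> norm_num) (by simp)
  rw [gramForm_apply]
  fin_cases i <;> fin_cases j <;> simp [gramFrame, hE.conj_theta, hw, hσ2, hσ3] <;> grind

/-- The lattice of vectors with coordinates in `O`. -/
def stdLattice (O : Subring K) : Submodule O (Fin 11 → K) :=
  Submodule.span O (Set.range fun i => Pi.single i 1)

theorem mem_stdLattice {x : Fin 11 → K} : x ∈ stdLattice O ↔ ∀ i, x i ∈ O := by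
  constructor
  · intro hx i
    induction hx using Submodule.span_induction with
    | mem x hx =>
      obtain ⟨j, rfl⟩ := hx
      by_cases h : i = j
      · subst h; simp
      · simp [h]
    | zero => exact O.zero_mem
    | add x y _ _ hx hy => exact O.add_mem hx hy
    | smul a x _ hx => exact O.mul_mem a.2 hx
  · intro hx
    rw [← Finset.univ_sum_single x]
    refine Submodule.sum_mem _ fun i _ => ?_
    have : Pi.single i (x i) = x i • (Pi.single i 1 : Fin 11 → K) := by
      rw [← Pi.single_smul, smul_eq_mul, mul_one]
    rw [this]
    exact smul_mem_of_mem (hx i) (Submodule.subset_span ⟨i, rfl⟩)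

theorem fg_stdLattice : (stdLattice O).FG :=
  Submodule.fg_span (Set.finite_range _)

theorem exists_smul_mem_stdLattice (hE : IsEisenstein σ O τ w) (x : Fin 11 → K) :
    ∃ d ∈ O, d ≠ 0 ∧ d • x ∈ stdLattice O := by
  choose d hd hd0 hdx using fun i => hE.exists_den (x i)
  refine ⟨∏ i, d i, O.prod_mem fun i _ => hd i, Finset.prod_ne_zero_iff.2 fun i _ => hd0 i,
    mem_stdLattice.2 fun i => ?_⟩
  rw [Pi.smul_apply, smul_eq_mul, ← Finset.prod_erase_mul _ _ (Finset.mem_univ i), mul_assoc]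
  exact O.mul_mem (O.prod_mem fun i _ => hd i) (hdx i)

theorem gramForm_eq_theta_mul (hE : IsEisenstein σ O τ w) {x y : Fin 11 → K}
    (hx : x ∈ stdLattice O) (hy : y ∈ stdLattice O) : ∃ a ∈ O, gramForm σ τ x y = τ * a := by
  rw [mem_stdLattice] at hx hy
  have hy' := fun i => hE.conj_mem _ (hy i)
  have hτ := hE.theta_mem
  refine ⟨-τ * (x 0 * σ (y 0) + (x 1 * σ (y 1) + x 2 * σ (y 2) + x 3 * σ (y 3) + x 4 * σ (y 4)) +
      (x 5 * σ (y 5) + x 6 * σ (y 6) + x 7 * σ (y 7) + x 8 * σ (y 8))) +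
      ((x 1 * σ (y 2) + x 2 * σ (y 3) + x 3 * σ (y 4)) -
        (x 2 * σ (y 1) + x 3 * σ (y 2) + x 4 * σ (y 3))) +
      ((x 5 * σ (y 6) + x 6 * σ (y 7) + x 7 * σ (y 8)) -
        (x 6 * σ (y 5) + x 7 * σ (y 6) + x 8 * σ (y 7))) + (x 9 * σ (y 10) - x 10 * σ (y 9)), ?_, ?_⟩
  · have hxy : ∀ i j, x i * σ (y j) ∈ O := fun i j => O.mul_mem (hx i) (hy' j)
    repeat' first
      | exact hxy _ _ | exact O.neg_mem hτ | apply O.add_mem | apply O.sub_mem | apply O.mul_mem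
  · rw [gramForm_apply]
    linear_combination (x 0 * σ (y 0) + (x 1 * σ (y 1) + x 2 * σ (y 2) + x 3 * σ (y 3) +
      x 4 * σ (y 4)) + (x 5 * σ (y 5) + x 6 * σ (y 6) + x 7 * σ (y 7) + x 8 * σ (y 8))) *
      hE.theta_sq

/-- The coordinates other than the zeroth of a vector of `τ` times the dual lattice are integral. -/
theorem mem_of_gramForm_eq_theta_mul [CharZero K] (hE : IsEisenstein σ O τ w) {x : Fin 11 → K}
    (h : ∀ y ∈ stdLattice O, ∃ a ∈ O, gramForm σ τ x y = τ * a) :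
    τ * x 0 ∈ O ∧ ∀ i, i ≠ 0 → x i ∈ O := by
  have hτ0 := hE.theta_ne_zero
  have hτ := hE.theta_sq
  have hτO := hE.theta_mem
  have h2 : (2 : K) ∈ O := by exact_mod_cast natCast_mem O 2
  have key : ∀ i, ∃ a ∈ O, gramForm σ τ x (Pi.single i 1) = τ * a := fun i =>
    h _ (Submodule.subset_span ⟨i, rfl⟩)
  choose a ha hxa using key
  have block : ∀ x₁ x₂ x₃ x₄ y₁ y₂ y₃ y₄ : K, y₁ ∈ O → y₂ ∈ O → y₃ ∈ O → y₄ ∈ O →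
      3 * x₁ - τ * x₂ = τ * y₁ → 3 * x₂ + τ * x₁ - τ * x₃ = τ * y₂ →
      3 * x₃ + τ * x₂ - τ * x₄ = τ * y₃ → 3 * x₄ + τ * x₃ = τ * y₄ →
      x₁ ∈ O ∧ x₂ ∈ O ∧ x₃ ∈ O ∧ x₄ ∈ O := by
    intro x₁ x₂ x₃ x₄ y₁ y₂ y₃ y₄ m₁ m₂ m₃ m₄ e₁ e₂ e₃ e₄
    have f₁ : x₂ = -τ * x₁ - y₁ := mul_left_cancel₀ hτ0 (by linear_combination -e₁ + x₁ * hτ)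
    have f₂ : x₃ = x₁ - τ * x₂ - y₂ := mul_left_cancel₀ hτ0 (by linear_combination -e₂ + x₂ * hτ)
    have f₃ : x₄ = x₂ - τ * x₃ - y₃ := mul_left_cancel₀ hτ0 (by linear_combination -e₃ + x₃ * hτ)
    have f₄ : y₄ = x₃ - τ * x₄ := mul_left_cancel₀ hτ0 (by linear_combination -e₄ + x₄ * hτ)
    have f₅ : x₁ = y₄ + τ * y₁ - 2 * y₂ - τ * y₃ := by
      rw [f₄, f₃, f₂, f₁]
      grind
    have n₁ : x₁ ∈ O := by
      rw [f₅]
      exact O.sub_mem (O.sub_mem (O.add_mem m₄ (O.mul_mem hτO m₁)) (O.mul_mem h2 m₂))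
        (O.mul_mem hτO m₃)
    have n₂ : x₂ ∈ O := f₁ ▸ O.sub_mem (O.mul_mem (O.neg_mem hτO) n₁) m₁
    have n₃ : x₃ ∈ O := f₂ ▸ O.sub_mem (O.sub_mem n₁ (O.mul_mem hτO n₂)) m₂
    exact ⟨n₁, n₂, n₃, f₃ ▸ O.sub_mem (O.sub_mem n₂ (O.mul_mem hτO n₃)) m₃⟩
  simp only [gramForm_apply] at hxa
  have e0 := hxa 0
  have e1 := hxa 1
  have e2 := hxa 2
  have e3 := hxa 3
  have e4 := hxa 4
  have e5 := hxa 5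
  have e6 := hxa 6
  have e7 := hxa 7
  have e8 := hxa 8
  have e9 := hxa 9
  have e10 := hxa 10
  simp at e0 e1 e2 e3 e4 e5 e6 e7 e8 e9 e10
  obtain ⟨n1, n2, n3, n4⟩ := block _ _ _ _ _ _ _ _ (ha 1) (ha 2) (ha 3) (ha 4) e1 e2
    e3 e4
  obtain ⟨n5, n6, n7, n8⟩ := block _ _ _ _ _ _ _ _ (ha 5) (ha 6) (ha 7) (ha 8) e5 e6
    e7 e8
  have n9 : x 9 ∈ O := by
    rw [show x 9 = a 10 by grind]
    exact ha 10
  have n10 : x 10 ∈ O := by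
    rw [show x 10 = -a 9 by grind]
    exact O.neg_mem (ha 9)
  refine ⟨?_, fun i hi => ?_⟩
  · rw [show τ * x 0 = -a 0 from mul_left_cancel₀ hτ0 (by linear_combination x 0 * hτ - e0)]
    exact O.neg_mem (ha 0)
  · fin_cases i
    · exact absurd rfl hi
    all_goals assumption

theorem isChordal_gramForm [CharZero K] (hE : IsEisenstein σ O τ w) {r : Fin 11 → K}
    (hr : r ∈ stdLattice O) (hrr : gramForm σ τ r r = 3)
    (hdiv : ∀ x ∈ stdLattice O, ∃ a ∈ O, gramForm σ τ r x = 3 * a) :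
    IsChordal (gramForm σ τ) τ (stdLattice O) r := by
  have hτ0 := hE.theta_ne_zero
  have hτ := hE.theta_sq
  have h3 : (3 : K) ≠ 0 := by norm_num
  have hB := conj_gramForm hE
  refine ⟨hr, hrr, fun x hx => ?_, fun x hxr hx => ?_⟩
  · obtain ⟨a, ha, h⟩ := hdiv x hx
    exact ⟨σ a, hE.conj_mem _ ha, by rw [← hB, h, map_mul, map_ofNat]⟩
  obtain ⟨hx0, hxi⟩ := mem_of_gramForm_eq_theta_mul hE hx
  obtain ⟨-, hri⟩ := mem_of_gramForm_eq_theta_mul hE (x := τ⁻¹ • r) fun y hy => by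
    obtain ⟨a, ha, h⟩ := hdiv y hy
    refine ⟨-a, O.neg_mem ha, ?_⟩
    rw [map_smul, LinearMap.smul_apply, h, smul_eq_mul, inv_mul_eq_iff_eq_mul₀ hτ0]
    linear_combination a * hτ
  have single : ∀ y c, gramForm σ τ y (Pi.single 0 c) = 3 * y 0 * σ c := fun y c => by
    simp [gramForm_apply]
  obtain ⟨q, hq⟩ : ∃ q, q = τ⁻¹ • r - Pi.single 0 ((τ⁻¹ • r) 0) := ⟨_, rfl⟩
  have zero_mem : ∀ y : Fin 11 → K, (∀ i, i ≠ 0 → y i ∈ O) →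
      y - Pi.single 0 (y 0) ∈ stdLattice O := by
    intro y hy
    refine mem_stdLattice.2 fun i => ?_
    by_cases h : i = 0
    · subst h; simp
    · simpa [h] using hy i h
  have hqΛ : q ∈ stdLattice O := hq ▸ zero_mem _ hri
  have hrq : r = Pi.single 0 (r 0) + τ • q := by
    rw [hq]
    ext i
    by_cases h : i = 0
    · subst h; simp
    · simp [h, mul_inv_cancel_left₀ hτ0]
  have hq0 : q 0 = 0 := by simp [hq]
  have eval : ∀ y : Fin 11 → K, gramForm σ τ y r =
      3 * y 0 * σ (r 0) - τ * gramForm σ τ (y - Pi.single 0 (y 0)) q := by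
    intro y
    have h1 : gramForm σ τ (Pi.single 0 (y 0)) q = 0 := by rw [← hB, single, hq0]; simp
    conv_lhs => rw [hrq]
    rw [map_add, single, map_smulₛₗ, hE.conj_theta, smul_eq_mul, map_sub, LinearMap.sub_apply, h1]
    ring
  have hrest : r - Pi.single 0 (r 0) = τ • q := by
    nth_rewrite 1 [hrq]
    simp
  obtain ⟨b, hb, hxb⟩ := gramForm_eq_theta_mul hE (zero_mem x hxi) hqΛ
  obtain ⟨c, hc, hqc⟩ := gramForm_eq_theta_mul hE hqΛ hqΛ
  have e1 : x 0 * σ (r 0) = -b := by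
    have := eval x
    rw [hxr, hxb] at this
    apply mul_left_cancel₀ h3
    linear_combination -this + b * hτ
  have e2 : r 0 * σ (r 0) = 1 - τ * c := by
    have := eval r
    rw [hrr, hrest, map_smul, LinearMap.smul_apply, hqc, smul_eq_mul] at this
    apply mul_left_cancel₀ h3
    linear_combination -this + τ * c * hτ
  refine mem_stdLattice.2 fun i => ?_
  by_cases hi : i = 0
  · subst hi
    rw [show x 0 = -b * r 0 + (τ * x 0) * c by linear_combination r 0 * e1 - x 0 * e2]
    exact O.add_mem (O.mul_mem (O.neg_mem hb) (mem_stdLattice.1 hr 0)) (O.mul_mem hx0 hc)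
  · exact hxi i hi

end Hermitian

theorem omega_mul_omega : ω * ω = -1 - ω := by
  have h : √3 * √3 = (3 : ℝ) := Real.mul_self_sqrt (by norm_num)
  apply Complex.ext
  · simp only [ω, Complex.mul_re, Complex.sub_re, Complex.neg_re, Complex.one_re]
    linear_combination -h / 4
  · simp only [ω, Complex.mul_im, Complex.sub_im, Complex.neg_im, Complex.one_im]
    ring

theorem normSq_add_mul_omega (a b : ℝ) : Complex.normSq (a + b * ω) = a ^ 2 - a * b + b ^ 2 := by
  have h : √3 * √3 = (3 : ℝ) := Real.mul_self_sqrt (by norm_num)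
  simp only [Complex.normSq_apply, ω, Complex.add_re, Complex.mul_re, Complex.ofReal_re,
    Complex.ofReal_im, Complex.add_im, Complex.mul_im]
  linear_combination b ^ 2 / 4 * h

theorem mem_Eis {z : ℂ} : z ∈ Eis ↔ ∃ a b : ℤ, z = a + b * ω := by
  constructor
  · intro hz
    induction hz using Subring.closure_induction with
    | mem x hx => exact ⟨0, 1, by rw [Set.mem_singleton_iff.1 hx]; simp⟩
    | zero => exact ⟨0, 0, by simp⟩
    | one => exact ⟨1, 0, by simp⟩
    | add x y _ _ hx hy =>
      obtain ⟨a, b, rfl⟩ := hx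
      obtain ⟨c, d, rfl⟩ := hy
      exact ⟨a + c, b + d, by push_cast; ring⟩
    | neg x _ hx =>
      obtain ⟨a, b, rfl⟩ := hx
      exact ⟨-a, -b, by push_cast; ring⟩
    | mul x y _ _ hx hy =>
      obtain ⟨a, b, rfl⟩ := hx
      obtain ⟨c, d, rfl⟩ := hy
      exact ⟨a * c - b * d, a * d + b * c - b * d, by
        push_cast; linear_combination b * d * omega_mul_omega⟩
  · rintro ⟨a, b, rfl⟩
    exact add_mem (intCast_mem _ a) (mul_mem (intCast_mem _ b) (Subring.subset_closure rfl))

/-- The field `ℚ(ω)`. -/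
def eisField : Subfield ℂ where
  carrier := {z | ∃ p q : ℚ, z = p + q * ω}
  zero_mem' := ⟨0, 0, by simp⟩
  one_mem' := ⟨1, 0, by simp⟩
  add_mem' := by
    rintro _ _ ⟨a, b, rfl⟩ ⟨c, d, rfl⟩
    exact ⟨a + c, b + d, by push_cast; ring⟩
  neg_mem' := by
    rintro _ ⟨a, b, rfl⟩
    exact ⟨-a, -b, by push_cast; ring⟩
  mul_mem' := by
    rintro _ _ ⟨a, b, rfl⟩ ⟨c, d, rfl⟩
    exact ⟨a * c - b * d, a * d + b * c - b * d, by
      push_cast; linear_combination b * d * omega_mul_omega⟩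
  inv_mem' := by
    rintro _ ⟨a, b, rfl⟩
    refine ⟨(a - b) / (a ^ 2 - a * b + b ^ 2), -b / (a ^ 2 - a * b + b ^ 2), ?_⟩
    have h := normSq_add_mul_omega a b
    rw [Complex.inv_def, map_add, map_mul, conj_omega]
    push_cast at h ⊢
    rw [h]
    push_cast
    simp only [map_ratCast]
    ring

theorem Eis_le_eisField {z : ℂ} (hz : z ∈ Eis) : z ∈ eisField := by
  obtain ⟨a, b, rfl⟩ := mem_Eis.1 hz
  exact ⟨a, b, by push_cast; rfl⟩

theorem conj_mem_eisField {z : ℂ} (hz : z ∈ eisField) : (starRingEnd ℂ) z ∈ eisField := by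
  obtain ⟨a, b, rfl⟩ := hz
  refine ⟨a - b, -b, ?_⟩
  rw [map_add, map_mul, conj_omega, map_ratCast, map_ratCast]
  push_cast
  ring

theorem normSq_of_mem_Eis {z : ℂ} (hz : z ∈ Eis) : ∃ n : ℕ, Complex.normSq z = n := by
  obtain ⟨a, b, rfl⟩ := mem_Eis.1 hz
  have h := normSq_add_mul_omega a b
  push_cast at h
  refine ⟨(a ^ 2 - a * b + b ^ 2).toNat, ?_⟩
  rw [h]
  have : ((a ^ 2 - a * b + b ^ 2).toNat : ℤ) = a ^ 2 - a * b + b ^ 2 :=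
    Int.toNat_of_nonneg (by nlinarith [sq_nonneg (a - b), sq_nonneg a, sq_nonneg b])
  exact_mod_cast congrArg (Int.cast : ℤ → ℝ) this.symm

theorem exists_normSq_sub_lt_one {z : ℂ} (hz : z ∈ eisField) :
    ∃ c ∈ Eis, Complex.normSq (z - c) < 1 := by
  obtain ⟨p, q, rfl⟩ := hz
  refine ⟨round p + round q * ω, mem_Eis.2 ⟨_, _, rfl⟩, ?_⟩
  have h := normSq_add_mul_omega (p - round p : ℚ) (q - round q : ℚ)
  have h1 := abs_le.1 (abs_sub_round p)
  have h2 := abs_le.1 (abs_sub_round q)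
  rw [show (p + q * ω - (round p + round q * ω) : ℂ) =
    ((p - round p : ℚ) : ℝ) + ((q - round q : ℚ) : ℝ) * ω by push_cast; ring, h]
  generalize p - round p = x at *
  generalize q - round q = y at *
  have : x ^ 2 - x * y + y ^ 2 < 1 := by nlinarith
  exact_mod_cast this

/-- Complex conjugation on `ℚ(ω)`. -/
def eisConj : eisField →+* eisField :=
  ((starRingEnd ℂ).comp eisField.subtype).codRestrict eisField fun z => conj_mem_eisField z.2

theorem coe_eisConj (z : eisField) : (eisConj z : ℂ) = (starRingEnd ℂ) (z : ℂ) := rfl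

/-- The Eisenstein integers as a subring of `ℚ(ω)`. -/
def eisRing : Subring eisField := Eis.comap eisField.subtype

theorem mem_eisRing {z : eisField} : z ∈ eisRing ↔ (z : ℂ) ∈ Eis := Iff.rfl

/-- `θ` as an element of `ℚ(ω)`. -/
def eisTheta : eisField := ⟨θ, Eis_le_eisField theta_mem_Eis⟩

/-- `-ω` as an element of `ℚ(ω)`. -/
def eisUnit : eisField := ⟨-ω, Eis_le_eisField (neg_mem omega_mem_Eis)⟩

theorem exists_generator (I : Submodule eisRing eisField) (hI : ∀ x ∈ I, x ∈ eisRing)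
    (h0 : ∃ x ∈ I, x ≠ 0) : ∃ a ∈ I, a ≠ 0 ∧ ∀ x ∈ I, ∃ q ∈ eisRing, x = q * a := by
  obtain ⟨a, ⟨haI, ha0⟩, hmin⟩ := WellFounded.has_min
    (measure fun x : eisField => ⌊Complex.normSq x⌋₊).wf {x | x ∈ I ∧ x ≠ 0} h0
  refine ⟨a, haI, ha0, fun x hx => ?_⟩
  obtain ⟨c, hc, hlt⟩ := exists_normSq_sub_lt_one (x / a).2
  obtain ⟨d, rfl⟩ : ∃ d : eisField, (d : ℂ) = c := ⟨⟨c, Eis_le_eisField hc⟩, rfl⟩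
  refine ⟨d, hc, ?_⟩
  by_contra hne
  refine hmin (x - d * a) ⟨I.sub_mem hx (I.smul_mem ⟨d, hc⟩ haI), sub_ne_zero.2 hne⟩ ?_
  change ⌊_⌋₊ < ⌊_⌋₊
  obtain ⟨n, hn⟩ := normSq_of_mem_Eis (mem_eisRing.1 (hI a haI))
  have ha0' : (a : ℂ) ≠ 0 := fun h => ha0 (Subtype.ext h)
  have hpos := Complex.normSq_pos.2 ha0'
  rw [hn, Nat.floor_natCast, Nat.floor_lt (Complex.normSq_nonneg _), ← hn]
  have : ((x - d * a : eisField) : ℂ) = ((x / a : eisField) - d) * a := by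
    push_cast
    field_simp
  rw [this, map_mul]
  nlinarith

theorem isEisenstein : IsEisenstein eisConj eisRing eisTheta eisUnit where
  conj_conj x := Subtype.ext (Complex.conj_conj _)
  conj_mem x hx := conj_mem_Eis hx
  exists_den := by
    rintro ⟨_, p, q, rfl⟩
    refine ⟨(p.den * q.den : ℕ), natCast_mem _ _, by simp, mem_eisRing.2 <|
      mem_Eis.2 ⟨p.num * q.den, q.num * p.den, ?_⟩⟩
    have hp : (p.den : ℂ) * p = p.num := by exact_mod_cast Rat.den_mul_eq_num p
    have hq : (q.den : ℂ) * q = q.num := by exact_mod_cast Rat.den_mul_eq_num q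
    push_cast
    linear_combination q.den * hp + p.den * ω * hq
  principal := exists_generator
  theta_mem := theta_mem_Eis
  w_mem := neg_mem omega_mem_Eis
  conj_theta := Subtype.ext <| by
    simp [coe_eisConj, eisTheta, θ]
  theta_sq := Subtype.ext <| by
    simp only [eisTheta, theta_eq]
    rw [Subfield.coe_mul, Subfield.coe_neg, show ((3 : eisField) : ℂ) = 3 from rfl]
    linear_combination 4 * omega_mul_omega
  w_add := Subtype.ext <| by simp [coe_eisConj, eisUnit, conj_omega]
  w_sub := Subtype.ext <| by simp [coe_eisConj, eisUnit, eisTheta, θ]; ring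
  int_of_real := by
    intro x hx h
    obtain ⟨a, b, hab⟩ := mem_Eis.1 (mem_eisRing.1 hx)
    have h := congrArg Subtype.val h
    rw [coe_eisConj, hab, map_add, map_mul, conj_omega, map_intCast, map_intCast] at h
    have him := congrArg Complex.im h
    simp [ω] at him
    have hb : (b : ℝ) = 0 := by
      have : (0 : ℝ) < √3 := by positivity
      nlinarith
    refine ⟨a, Subtype.ext ?_⟩
    rw [hab, Int.cast_eq_zero.1 hb]
    simp
  residue := by
    intro x hx
    obtain ⟨a, b, hab⟩ := mem_Eis.1 (mem_eisRing.1 hx)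
    have key : ∀ m e : ℤ, a + b = 3 * m + e → ∃ y ∈ eisRing, x = e + eisTheta * y := by
      intro m e h
      have hy : (b * (1 + ω) - m * θ : ℂ) ∈ Eis := by
        refine mem_Eis.2 ⟨b - m, b - 2 * m, ?_⟩
        rw [theta_eq]; push_cast; ring
      refine ⟨⟨_, Eis_le_eisField hy⟩, hy, Subtype.ext ?_⟩
      rw [hab]
      have h : (a + b : ℂ) = 3 * m + e := by exact_mod_cast h
      simp only [eisTheta, theta_eq]
      push_cast
      linear_combination h + (4 * m - 2 * b) * omega_mul_omega
    obtain ⟨m, h | h | h⟩ : ∃ m : ℤ, a + b = 3 * m + 0 ∨ a + b = 3 * m + 1 ∨ a + b = 3 * m + -1 :=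
      ⟨(a + b + 1) / 3, by omega⟩
    · obtain ⟨y, hy, h⟩ := key _ _ h
      exact ⟨y, hy, .inl (by simpa using h)⟩
    · obtain ⟨y, hy, h⟩ := key _ _ h
      exact ⟨y, hy, .inr (.inl (by simpa using h))⟩
    · obtain ⟨y, hy, h⟩ := key _ _ h
      exact ⟨y, hy, .inr (.inr (by simpa using h))⟩
  norm_ne x h := by
    have h := congrArg (fun z : eisField => (z : ℂ).re) h
    simp [coe_eisConj] at h
    nlinarith [mul_self_nonneg (x : ℂ).re, mul_self_nonneg (x : ℂ).im]

/-- The inclusion of `Λ` in the vector space `ℚ(ω)¹¹`. -/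
def eisVec (x : Fin 11 → Eis) : Fin 11 → eisField := fun i => ⟨x i, Eis_le_eisField (x i).2⟩

theorem eisVec_mem (x : Fin 11 → Eis) : eisVec x ∈ stdLattice eisRing :=
  mem_stdLattice.2 fun i => (x i).2

theorem eisVec_injective : Function.Injective eisVec := fun x y h => by
  ext i
  exact congrArg (fun z : Fin 11 → eisField => (z i : ℂ)) h

theorem exists_eisVec_eq {z : Fin 11 → eisField} (hz : z ∈ stdLattice eisRing) :
    ∃ x, eisVec x = z :=
  ⟨fun i => ⟨z i, mem_stdLattice.1 hz i⟩, rfl⟩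

theorem eisVec_add (x y : Fin 11 → Eis) : eisVec (x + y) = eisVec x + eisVec y := rfl

theorem eisVec_smul (a : Eis) (x : Fin 11 → Eis) :
    eisVec (a • x) = (⟨a, Eis_le_eisField a.2⟩ : eisField) • eisVec x := rfl

theorem coe_gramForm_eisVec (x y : Fin 11 → Eis) :
    (gramForm eisConj eisTheta (eisVec x) (eisVec y) : ℂ) = hermE x y := by
  have h3 : ((3 : eisField) : ℂ) = 3 := rfl
  rw [gramForm_apply]
  simp [hermE, Fin.sum_univ_succ, Lam11, Lam10, Bmat, Cmat, coe_eisConj, eisTheta, eisVec, h3]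
  ring

theorem isChordal_eisVec {r : Fin 11 → Eis} (hr : hermE r r = 3) (h : innerSetE r = threeEis) :
    IsChordal (gramForm eisConj eisTheta) eisTheta (stdLattice eisRing) (eisVec r) := by
  refine isChordal_gramForm isEisenstein (eisVec_mem r)
    (Subtype.ext ((coe_gramForm_eisVec r r).trans hr)) fun z hz => ?_
  obtain ⟨x, rfl⟩ := exists_eisVec_eq hz
  obtain ⟨e, he⟩ : hermE r x ∈ threeEis := h ▸ ⟨x, rfl⟩
  exact ⟨⟨e, Eis_le_eisField e.2⟩, e.2, Subtype.ext ((coe_gramForm_eisVec r x).trans he)⟩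

theorem exists_linearEquiv_eisVec {G : (Fin 11 → eisField) ≃ₗ[eisField] (Fin 11 → eisField)}
    (hG : ∀ x, x ∈ stdLattice eisRing ↔ G x ∈ stdLattice eisRing) :
    ∃ γ : (Fin 11 → Eis) ≃ₗ[Eis] (Fin 11 → Eis), ∀ x, eisVec (γ x) = G (eisVec x) := by
  choose g hg using fun x => exists_eisVec_eq ((hG _).1 (eisVec_mem x))
  let f : (Fin 11 → Eis) →ₗ[Eis] (Fin 11 → Eis) :=
    { toFun := g
      map_add' := fun x y => eisVec_injective <| by simp only [hg, eisVec_add, map_add]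
      map_smul' := fun a x => eisVec_injective <| by
        simp only [hg, eisVec_smul, map_smul, RingHom.id_apply] }
  refine ⟨LinearEquiv.ofBijective f ⟨fun x y h => ?_, fun y => ?_⟩, hg⟩
  · have := congrArg eisVec h
    change eisVec (g x) = eisVec (g y) at this
    rw [hg, hg] at this
    exact eisVec_injective (G.injective this)
  · obtain ⟨x, hx⟩ := exists_eisVec_eq (z := G.symm (eisVec y)) <| by
      rw [hG, G.apply_symm_apply]
      exact eisVec_mem y
    refine ⟨x, eisVec_injective ?_⟩
    change eisVec (g x) = _
    rw [hg, hx, G.apply_symm_apply]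

/-- Any two chordal roots of `Λ` are equivalent under the isometry group
`Γ` of `Λ`. -/
theorem stmt_8 :
    ∀ r s : Fin 11 → Eis, hermE r r = 3 → hermE s s = 3 →
      innerSetE r = threeEis → innerSetE s = threeEis →
      ∃ γ : (Fin 11 → Eis) ≃ₗ[Eis] (Fin 11 → Eis),
        (∀ x y : Fin 11 → Eis, hermE (γ x) (γ y) = hermE x y) ∧ γ r = s := by
  intro r s hr hs hr' hs'
  obtain ⟨G, hG, hGr, hGΛ⟩ := IsChordal.exists_isometry isEisenstein (conj_gramForm isEisenstein)
    fg_stdLattice (fun x hx y hy => gramForm_eq_theta_mul isEisenstein hx hy)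
    (exists_smul_mem_stdLattice isEisenstein) (isSystem_gramFrame isEisenstein) (i₀ := 10)
    (if_pos rfl) (fun i hi => if_neg hi) (j := 0) (k := 1) (by decide) (by decide) (by decide)
    (isChordal_eisVec hr hr') (isChordal_eisVec hs hs')
  obtain ⟨γ, hγ⟩ := exists_linearEquiv_eisVec hGΛ
  refine ⟨γ, fun x y => ?_, eisVec_injective ((hγ r).trans hGr)⟩
  rw [← coe_gramForm_eisVec, ← coe_gramForm_eisVec, hγ, hγ, hG]
end
end
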